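/- arXiv:0704.1217 — 2 statements merged into one kernel-verified Lean document; each statement's English description precedes it below -/
import Mathlib

section
/- There is an absolute constant C such that for all B ≥ 2, the number of primitive vectors x ∈ ℤ^4 satisfying x_1x_2(x_1+x_2) + x_4(x_1+x_2+x_3)^2 = 0, max_{1≤i≤4}|x_i| ≤ B, and x_4·(x_1+x_2+x_3) ≠ 0 is at most C · B (log B)^6. -/
theorem card_le_of_slopes_separated (P : Finset (ℕ × ℕ)) {N q θ η : ℝ} (hq : 0 < q)
    (hN : 0 < N) (hη : 0 ≤ η)
    (h1 : ∀ a ∈ P, N ≤ a.2 ∧ (a.2 : ℝ) < 2 * N)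
    (h2 : ∀ a ∈ P, |(a.1 : ℝ) / a.2 - θ| ≤ η)
    (h3 : ∀ a ∈ P, ∀ b ∈ P, a ≠ b → q ≤ |(a.1 : ℝ) * b.2 - b.1 * a.2|) :
    (P.card : ℝ) ≤ 1 + 8 * η * N ^ 2 / q := by
  set φ : ℕ × ℕ → ℕ := fun a => ⌊((a.1 : ℝ) / a.2 - θ + η) * (4 * N ^ 2 / q)⌋₊ with hφ
  have hc : 0 < 4 * N ^ 2 / q := by positivity
  have hmem : ∀ a ∈ P, φ a ∈ Finset.range (⌊8 * η * N ^ 2 / q⌋₊ + 1) := by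
    intro a ha
    rw [Finset.mem_range, Nat.lt_succ_iff]
    apply Nat.floor_le_floor
    have := (abs_le.1 (h2 a ha)).2
    calc ((a.1 : ℝ) / a.2 - θ + η) * (4 * N ^ 2 / q) ≤ (2 * η) * (4 * N ^ 2 / q) := by
          gcongr; linarith
      _ = _ := by ring
  have hinj : Set.InjOn φ P := by
    intro a ha b hb hab
    by_contra hne
    have h := h3 a ha b hb hne
    have hb2 : 0 < (b.2 : ℝ) := lt_of_lt_of_le hN (h1 b hb).1
    have ha2 : 0 < (a.2 : ℝ) := lt_of_lt_of_le hN (h1 a ha).1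
    have hfl : |((a.1 : ℝ) / a.2 - θ + η) * (4 * N ^ 2 / q)
        - ((b.1 : ℝ) / b.2 - θ + η) * (4 * N ^ 2 / q)| < 1 := by
      have h0a := (abs_le.1 (h2 a ha)).1
      have h0b := (abs_le.1 (h2 b hb)).1
      have e1 := Nat.floor_le (a := ((a.1 : ℝ) / a.2 - θ + η) * (4 * N ^ 2 / q))
        (mul_nonneg (by linarith) hc.le)
      have e2 := Nat.floor_le (a := ((b.1 : ℝ) / b.2 - θ + η) * (4 * N ^ 2 / q))
        (mul_nonneg (by linarith) hc.le)
      have e3 := Nat.lt_floor_add_one (((a.1 : ℝ) / a.2 - θ + η) * (4 * N ^ 2 / q))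
      have e4 := Nat.lt_floor_add_one (((b.1 : ℝ) / b.2 - θ + η) * (4 * N ^ 2 / q))
      have hab' : (⌊((a.1 : ℝ) / a.2 - θ + η) * (4 * N ^ 2 / q)⌋₊ : ℝ)
        = ⌊((b.1 : ℝ) / b.2 - θ + η) * (4 * N ^ 2 / q)⌋₊ := by exact_mod_cast hab
      rw [abs_lt]; constructor <;> linarith
    have hrew : ((a.1 : ℝ) / a.2 - θ + η) * (4 * N ^ 2 / q)
        - ((b.1 : ℝ) / b.2 - θ + η) * (4 * N ^ 2 / q)
        = ((a.1 : ℝ) * b.2 - b.1 * a.2) * (4 * N ^ 2 / (q * (a.2 * b.2))) := by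
      field_simp
      ring
    have hpos : 0 < 4 * N ^ 2 / (q * (a.2 * b.2)) := by positivity
    rw [hrew, abs_mul, abs_of_pos hpos] at hfl
    have : q * (4 * N ^ 2 / (q * (a.2 * b.2))) < 1 :=
      lt_of_le_of_lt (mul_le_mul_of_nonneg_right h hpos.le) hfl
    have h5 : q * (4 * N ^ 2 / (q * (a.2 * b.2))) = 4 * N ^ 2 / (a.2 * b.2) := by field_simp
    rw [h5, div_lt_one (by positivity)] at this
    have := mul_lt_mul'' (h1 a ha).2 (h1 b hb).2 ha2.le hb2.le
    nlinarith
  have hcard : P.card ≤ ⌊8 * η * N ^ 2 / q⌋₊ + 1 := by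
    simpa using Finset.card_le_card_of_injOn φ hmem hinj
  calc (P.card : ℝ) ≤ (⌊8 * η * N ^ 2 / q⌋₊ : ℝ) + 1 := by exact_mod_cast hcard
    _ ≤ 8 * η * N ^ 2 / q + 1 := by gcongr; exact Nat.floor_le (by positivity)
    _ = _ := by ring

theorem card_square_class_pairs_le (R : Finset (ℕ × ℕ)) {n c U : ℕ} (hn : 0 < n) (hc : 0 < c)
    (hcn : c ∣ n) {a b : ℤ} (ha : IsCoprime a ((n * c : ℕ) : ℤ)) (hb : IsCoprime b (n : ℤ))
    (h1 : ∀ z ∈ R, U ≤ z.1 ∧ z.1 < 2 * U) (h2 : ∀ z ∈ R, z.2 < n * c)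
    (h3 : ∀ z ∈ R, Nat.Coprime z.2 c)
    (h4 : ∀ z ∈ R, ((n * c : ℕ) : ℤ) ∣ a * (z.2 : ℤ) ^ 2 + b * (z.1 : ℤ)) :
    R.card ≤ 2 * (U + n) := by
  set φ : ℕ × ℕ → ℕ × ℕ × ℕ := fun z => (z.2 % n, 2 * z.2 / (n * c), (z.1 - U) / n) with hφ
  have hmem : ∀ z ∈ R, φ z ∈ Finset.range n ×ˢ Finset.range 2 ×ˢ Finset.range (U / n + 1) := by
    intro z hz
    simp only [hφ, Finset.mem_product, Finset.mem_range]
    refine ⟨Nat.mod_lt _ hn, ?_, ?_⟩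
    · rw [Nat.div_lt_iff_lt_mul (by positivity)]
      have := h2 z hz
      omega
    · rw [Nat.lt_succ_iff]
      apply Nat.div_le_div_right
      have := h1 z hz
      omega
  have hinj : Set.InjOn φ R := by
    intro z hz w hw h
    simp only [hφ, Prod.mk.injEq] at h
    obtain ⟨e1, e2, e3⟩ := h
    have hmod : (n : ℤ) ∣ (z.2 : ℤ) - w.2 :=
      (Nat.modEq_iff_dvd.1 (show w.2 ≡ z.2 [MOD n] from e1.symm))
    have hnq : (n : ℤ) ∣ ((n * c : ℕ) : ℤ) := by push_cast; exact dvd_mul_right _ _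
    have hm : z.1 = w.1 := by
      have hd : (n : ℤ) ∣ b * ((z.1 : ℤ) - w.1) := by
        have := dvd_sub (hnq.trans (h4 z hz)) (hnq.trans (h4 w hw))
        have h' : b * ((z.1 : ℤ) - w.1) = (a * (z.2 : ℤ) ^ 2 + b * (z.1 : ℤ)
          - (a * (w.2 : ℤ) ^ 2 + b * (w.1 : ℤ))) - ((z.2 : ℤ) - w.2) * (a * (z.2 + w.2)) := by ring
        rw [h']
        exact dvd_sub this (hmod.mul_right _)
      have hd := hb.symm.dvd_of_dvd_mul_left hd
      have hd' : w.1 ≡ z.1 [MOD n] := Nat.modEq_iff_dvd.2 hd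
      have k1 := h1 z hz
      have k2 := h1 w hw
      have hd2 : w.1 - U ≡ z.1 - U [MOD n] := by
        apply Nat.ModEq.add_right_cancel' U
        rwa [Nat.sub_add_cancel k1.1, Nat.sub_add_cancel k2.1]
      have m1 := Nat.div_add_mod (z.1 - U) n
      have m2 := Nat.div_add_mod (w.1 - U) n
      have hd3 : (w.1 - U) % n = (z.1 - U) % n := hd2
      rw [e3, ← hd3, m2] at m1
      omega
    have ht : z.2 = w.2 := by
      have hd := dvd_sub (h4 z hz) (h4 w hw)
      rw [hm, show a * (z.2 : ℤ) ^ 2 + b * (w.1 : ℤ) - (a * (w.2 : ℤ) ^ 2 + b * (w.1 : ℤ))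
        = a * (((z.2 : ℤ) - w.2) * (z.2 + w.2)) by ring] at hd
      have hd := ha.symm.dvd_of_dvd_mul_left hd
      obtain ⟨r, hr⟩ := hmod
      rw [hr] at hd
      push_cast at hd
      rw [mul_assoc] at hd
      have hn' : (n : ℤ) ≠ 0 := by exact_mod_cast hn.ne'
      have hd := (mul_dvd_mul_iff_left hn').1 hd
      have hcn' : (c : ℤ) ∣ n := by exact_mod_cast hcn
      have hz2 : (z.2 : ℤ) + w.2 = 2 * w.2 + n * r := by linarith
      rw [hz2, show r * (2 * (w.2 : ℤ) + n * r) = (w.2 : ℤ) * (2 * r) + n * (r * r) by ring] at hd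
      have hd := (dvd_add_left (hcn'.mul_right (r * r))).1 hd
      have hcop : IsCoprime (c : ℤ) (w.2 : ℤ) := (Nat.isCoprime_iff_coprime.2 (h3 w hw)).symm
      have hd := hcop.dvd_of_dvd_mul_left hd
      have hd2 : ((n * c : ℕ) : ℤ) ∣ ((2 * z.2 : ℕ) : ℤ) - ((2 * w.2 : ℕ) : ℤ) := by
        push_cast
        rw [show 2 * (z.2 : ℤ) - 2 * w.2 = n * (2 * r) by linarith]
        exact mul_dvd_mul_left _ hd
      have hd3 : (2 * w.2) % (n * c) = (2 * z.2) % (n * c) := Nat.modEq_iff_dvd.2 hd2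
      have k1 := Nat.div_add_mod (2 * z.2) (n * c)
      have k2 := Nat.div_add_mod (2 * w.2) (n * c)
      rw [e2, ← hd3] at k1
      omega
    exact Prod.ext hm ht
  calc R.card ≤ (Finset.range n ×ˢ Finset.range 2 ×ˢ Finset.range (U / n + 1)).card :=
        Finset.card_le_card_of_injOn φ hmem hinj
    _ = n * (2 * (U / n + 1)) := by simp
    _ = 2 * (n * (U / n) + n) := by ring
    _ ≤ 2 * (U + n) := by gcongr; exact Nat.mul_div_le _ _

/-- Points of the torsor `∑ εᵢ sᵢ vᵢ yᵢ² = 0` with positive coordinates and coprime terms. -/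
def IsTorsorPoint (ε : Fin 3 → ℤ) (s : Fin 3 → ℕ) (z : (Fin 3 → ℕ) × (Fin 3 → ℕ)) : Prop :=
  (∀ i, 0 < z.1 i) ∧ (∀ i, 0 < z.2 i) ∧
    ∑ i, ε i * ((s i * z.1 i * z.2 i ^ 2 : ℕ) : ℤ) = 0 ∧
    ∀ i j, i ≠ j → Nat.Coprime (s i * z.1 i * z.2 i) (s j * z.1 j * z.2 j)

/-- Torsor points in a dyadic box. -/
def InTorsorBox (ε : Fin 3 → ℤ) (s U Y : Fin 3 → ℕ) (z : (Fin 3 → ℕ) × (Fin 3 → ℕ)) : Prop :=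
  IsTorsorPoint ε s z ∧
    ∀ i, (U i ≤ z.1 i ∧ z.1 i < 2 * U i) ∧ (Y i ≤ z.2 i ∧ z.2 i < 2 * Y i)

theorem fin_three_cases {i j k : Fin 3} (hij : i ≠ j) (hjk : j ≠ k) (hik : i ≠ k) (l : Fin 3) :
    l = i ∨ l = j ∨ l = k := by
  revert i j k l; decide

theorem fin_three_sum {M : Type*} [AddCommMonoid M] {i j k : Fin 3} (hij : i ≠ j) (hjk : j ≠ k)
    (hik : i ≠ k) (f : Fin 3 → M) : ∑ l, f l = f i + f j + f k := by
  have : (Finset.univ : Finset (Fin 3)) = {i, j, k} := by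
    ext l; simpa using fin_three_cases hij hjk hik l
  rw [this, Finset.sum_insert (by simp [hij, hik]), Finset.sum_insert (by simp [hjk]),
    Finset.sum_singleton, add_assoc]

theorem card_le_card_mul_of_fibers {α β : Type*} [DecidableEq β] (S : Finset α) (f : α → β)
    (T : Finset β) (hf : ∀ a ∈ S, f a ∈ T) {M : ℝ}
    (hM : ∀ b ∈ T, ((S.filter fun a => f a = b).card : ℝ) ≤ M) :
    (S.card : ℝ) ≤ T.card * M := by
  rw [Finset.card_eq_sum_card_fiberwise hf]
  push_cast
  calc _ ≤ ∑ _b ∈ T, M := Finset.sum_le_sum hM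
    _ = _ := by simp

theorem eq_of_cross_mul_eq {a b c d : ℕ} (hab : a.Coprime b) (hcd : c.Coprime d)
    (h : a * d = c * b) : a = c ∧ b = d := by
  constructor
  · exact Nat.dvd_antisymm (hab.dvd_of_dvd_mul_right ⟨d, h.symm⟩) (hcd.dvd_of_dvd_mul_right ⟨b, h⟩)
  · refine Nat.dvd_antisymm (hab.symm.dvd_of_dvd_mul_left ⟨c, ?_⟩)
      (hcd.symm.dvd_of_dvd_mul_left ⟨a, ?_⟩)
    · rw [h]; ring
    · rw [← h]; ring

theorem le_abs_cross_of_dvd {q : ℕ} {a b c d : ℕ} (hab : a.Coprime b) (hcd : c.Coprime d)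
    (hne : (a, b) ≠ (c, d)) (h : (q : ℤ) ∣ (a : ℤ) * d - c * b) :
    (q : ℝ) ≤ |(a : ℝ) * d - c * b| := by
  have h0 : (a : ℤ) * d - c * b ≠ 0 := by
    intro h0
    apply hne
    have : a * d = c * b := by zify; linarith
    obtain ⟨h1, h2⟩ := eq_of_cross_mul_eq hab hcd this
    rw [h1, h2]
  have := Int.le_of_dvd (abs_pos.2 h0) ((dvd_abs _ _).2 h)
  exact_mod_cast this

section Torsor

variable {ε : Fin 3 → ℤ} {s : Fin 3 → ℕ} {z w : (Fin 3 → ℕ) × (Fin 3 → ℕ)} {i j k : Fin 3}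

theorem IsTorsorPoint.sum_eq (hz : IsTorsorPoint ε s z) (hij : i ≠ j) (hjk : j ≠ k)
    (hik : i ≠ k) :
    ε i * ((s i : ℤ) * z.1 i * (z.2 i : ℤ) ^ 2) + ε j * ((s j : ℤ) * z.1 j * (z.2 j : ℤ) ^ 2)
      + ε k * ((s k : ℤ) * z.1 k * (z.2 k : ℤ) ^ 2) = 0 := by
  have := hz.2.2.1
  rw [fin_three_sum hij hjk hik] at this
  push_cast at this
  exact this

theorem IsTorsorPoint.coprime_v (hz : IsTorsorPoint ε s z) (hij : i ≠ j) :
    (z.1 i).Coprime (z.1 j) :=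
  Nat.Coprime.coprime_dvd_left ⟨s i * z.2 i, by ring⟩
    (Nat.Coprime.coprime_dvd_right ⟨s j * z.2 j, by ring⟩ (hz.2.2.2 i j hij))

theorem IsTorsorPoint.coprime_y (hz : IsTorsorPoint ε s z) (hij : i ≠ j) :
    (z.2 i).Coprime (z.2 j) :=
  Nat.Coprime.coprime_dvd_left ⟨s i * z.1 i, by ring⟩
    (Nat.Coprime.coprime_dvd_right ⟨s j * z.1 j, by ring⟩ (hz.2.2.2 i j hij))

theorem IsTorsorPoint.coprime_term (hz : IsTorsorPoint ε s z) (hij : i ≠ j) :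
    (s i * z.1 i * z.2 i).Coprime (s j * z.2 j ^ 2) := by
  apply Nat.Coprime.mul_right
  · exact Nat.Coprime.coprime_dvd_right ⟨z.1 j * z.2 j, by ring⟩ (hz.2.2.2 i j hij)
  · apply Nat.Coprime.pow_right
    exact Nat.Coprime.coprime_dvd_right ⟨s j * z.1 j, by ring⟩ (hz.2.2.2 i j hij)

theorem IsTorsorPoint.dvd (hz : IsTorsorPoint ε s z) (hij : i ≠ j) (hjk : j ≠ k)
    (hik : i ≠ k) : ((s k * z.2 k ^ 2 : ℕ) : ℤ) ∣
      ε i * ((s i : ℤ) * z.1 i * (z.2 i : ℤ) ^ 2)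
        + ε j * ((s j : ℤ) * z.1 j * (z.2 j : ℤ) ^ 2) := by
  have := hz.sum_eq hij hjk hik
  refine ⟨-(ε k * z.1 k), ?_⟩
  push_cast
  linear_combination this

theorem IsTorsorPoint.ext (hz : IsTorsorPoint ε s z) (hw : IsTorsorPoint ε s w)
    (hε : ∀ i, ε i ≠ 0) (hs : ∀ i, 0 < s i) (hij : i ≠ j) (hjk : j ≠ k) (hik : i ≠ k)
    (h1 : z.1 i = w.1 i) (h2 : z.1 j = w.1 j) (hy : z.2 = w.2) : z = w := by
  have e1 := hz.sum_eq hij hjk hik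
  have e2 := hw.sum_eq hij hjk hik
  rw [hy, h1, h2] at e1
  have hne : ε k * ((s k : ℤ) * (w.2 k : ℤ) ^ 2) ≠ 0 := by
    have := (hs k).ne'
    have := (hw.2.1 k).ne'
    have := hε k
    positivity
  have h3 : z.1 k = w.1 k := by
    have : ε k * ((s k : ℤ) * (w.2 k : ℤ) ^ 2) * (z.1 k : ℤ)
        = ε k * ((s k : ℤ) * (w.2 k : ℤ) ^ 2) * (w.1 k : ℤ) := by linear_combination e1 - e2
    exact_mod_cast mul_left_cancel₀ hne this
  refine Prod.ext (funext fun l => ?_) hy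
  rcases fin_three_cases hij hjk hik l with rfl | rfl | rfl <;> assumption

theorem card_torsorBox_le_of_fixed_y (S : Finset ((Fin 3 → ℕ) × (Fin 3 → ℕ))) {U Y : Fin 3 → ℕ}
    (hε : ∀ i, IsUnit (ε i)) (hs : ∀ i, 0 < s i) (hU : ∀ i, 0 < U i) (hY : ∀ i, 0 < Y i)
    (hS : ∀ z ∈ S, InTorsorBox ε s U Y z) (hij : i ≠ j) (hjk : j ≠ k) (hik : i ≠ k) :
    (S.card : ℝ) ≤ ((Y i : ℝ) * Y j * Y k) * (1 + 16 * U i * U j / (s k * Y k ^ 2)) := by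
  have hT : ((Fintype.piFinset fun l => Finset.Ico (Y l) (2 * Y l)).card : ℝ)
      = (Y i : ℝ) * Y j * Y k := by
    have : (Finset.univ : Finset (Fin 3)) = {i, j, k} := by
      ext l; simpa using fin_three_cases hij hjk hik l
    rw [Fintype.card_piFinset, this, Finset.prod_insert (by simp [hij, hik]),
      Finset.prod_insert (by simp [hjk]), Finset.prod_singleton]
    simp only [Nat.card_Ico, two_mul, Nat.add_sub_cancel]
    push_cast; ring
  rw [← hT]
  refine card_le_card_mul_of_fibers S Prod.snd _ ?_ ?_
  · intro z hz
    simp only [Fintype.mem_piFinset, Finset.mem_Ico]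
    exact fun l => ((hS z hz).2 l).2
  intro y hy
  simp only [Fintype.mem_piFinset, Finset.mem_Ico] at hy
  set F := S.filter fun a => a.2 = y with hF
  have hFS : ∀ z ∈ F, InTorsorBox ε s U Y z ∧ z.2 = y := fun z hz =>
    ⟨hS z (Finset.mem_filter.1 hz).1, (Finset.mem_filter.1 hz).2⟩
  have hinj : Set.InjOn (fun z : (Fin 3 → ℕ) × (Fin 3 → ℕ) => (z.1 i, z.1 j)) F := by
    intro z hz w hw h
    simp only [Prod.mk.injEq] at h
    exact (hFS z hz).1.1.ext (hFS w hw).1.1 (fun l => (hε l).ne_zero) hs hij hjk hik h.1 h.2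
      ((hFS z hz).2.trans (hFS w hw).2.symm)
  rw [← Finset.card_image_of_injOn hinj]
  have hUj : (0 : ℝ) < U j := by exact_mod_cast hU j
  have hUi : (0 : ℝ) < U i := by exact_mod_cast hU i
  have hsk : (0 : ℝ) < s k := by exact_mod_cast hs k
  have hYk : (0 : ℝ) < Y k := by exact_mod_cast hY k
  have key := card_le_of_slopes_separated
    (F.image (fun z : (Fin 3 → ℕ) × (Fin 3 → ℕ) => (z.1 i, z.1 j)))
    (N := U j) (q := s k * Y k ^ 2) (θ := 0) (η := 2 * U i / U j) (by positivity) hUj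
    (by positivity) ?_ ?_ ?_
  · refine key.trans (le_of_eq ?_)
    field_simp
    ring
  · intro a ha
    obtain ⟨z, hz, rfl⟩ := Finset.mem_image.1 ha
    have := ((hFS z hz).1.2 j).1
    exact ⟨by exact_mod_cast this.1, by exact_mod_cast this.2⟩
  · intro a ha
    obtain ⟨z, hz, rfl⟩ := Finset.mem_image.1 ha
    have h1 := ((hFS z hz).1.2 j).1
    have h2 := ((hFS z hz).1.2 i).1
    have h3 : (U j : ℝ) ≤ z.1 j := by exact_mod_cast h1.1
    have h4 : (z.1 i : ℝ) ≤ 2 * U i := by exact_mod_cast h2.2.le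
    rw [sub_zero, abs_of_nonneg (by positivity)]
    gcongr
  · intro a ha b hb hne
    obtain ⟨z, hz, rfl⟩ := Finset.mem_image.1 ha
    obtain ⟨w, hw, rfl⟩ := Finset.mem_image.1 hb
    obtain ⟨⟨hz, -⟩, hzy⟩ := hFS z hz
    obtain ⟨⟨hw, -⟩, hwy⟩ := hFS w hw
    have hdvd : ((s k * y k ^ 2 : ℕ) : ℤ) ∣ (z.1 i : ℤ) * w.1 j - w.1 i * z.1 j := by
      have d1 := hz.dvd hij hjk hik
      have d2 := hw.dvd hij hjk hik
      rw [hzy] at d1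
      rw [hwy] at d2
      have hc : IsCoprime ((s k * y k ^ 2 : ℕ) : ℤ) (ε i * ((s i * y i ^ 2 : ℕ) : ℤ)) := by
        have h1 := hz.coprime_term hik
        rw [hzy] at h1
        have h2 : (s i * y i ^ 2).Coprime (s k * y k ^ 2) := by
          apply Nat.Coprime.mul_left
          · exact h1.coprime_dvd_left ⟨z.1 i * y i, by ring⟩
          · exact (h1.coprime_dvd_left ⟨s i * z.1 i, by ring⟩).pow_left 2
        exact (isCoprime_mul_unit_left_right (hε i) _ _).2 (Nat.isCoprime_iff_coprime.2 h2).symm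
      apply hc.dvd_of_dvd_mul_left
      have := dvd_sub (d1.mul_left (w.1 j : ℤ)) (d2.mul_left (z.1 j : ℤ))
      convert this using 1
      push_cast
      ring
    refine le_trans ?_ (le_abs_cross_of_dvd (hz.coprime_v hij) (hw.coprime_v hij) hne hdvd)
    push_cast
    have : (Y k : ℝ) ≤ y k := by exact_mod_cast (hy k).1
    gcongr

end Torsor

theorem exists_slope_near {A B K Y₁ Y₂ δ e : ℝ} (hA : 0 < A) (hB : 0 < B) (hY₁ : 0 < Y₁)
    (hY₂ : 0 < Y₂) (he : e = 1 ∨ e = -1) (hδ : 1 ≤ δ ∨ K ≤ 8 * δ * (A * Y₁ ^ 2)) :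
    ∃ θ : ℝ, ∀ m n : ℝ, Y₁ ≤ m → m < 2 * Y₁ → Y₂ ≤ n → n < 2 * Y₂ →
      |A * m ^ 2 + e * (B * n ^ 2)| ≤ K → |m / n - θ| ≤ 16 * δ * Y₁ / Y₂ := by
  have trivial_bound : 1 ≤ 8 * δ → ∀ m n : ℝ, Y₁ ≤ m → m < 2 * Y₁ → Y₂ ≤ n → n < 2 * Y₂ →
      |m / n - 0| ≤ 16 * δ * Y₁ / Y₂ := by
    intro h m n h1 h2 h3 h4
    have hm : 0 < m := hY₁.trans_le h1
    rw [sub_zero, abs_of_nonneg (div_nonneg hm.le (hY₂.trans_le h3).le)]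
    have h5 : 2 * Y₁ ≤ 16 * δ * Y₁ := by nlinarith
    exact div_le_div₀ (by linarith) (h2.le.trans h5) hY₂ h3
  rcases hδ with hδ | hδ
  · exact ⟨0, fun m n h1 h2 h3 h4 _ => trivial_bound (by linarith) m n h1 h2 h3 h4⟩
  rcases he with rfl | rfl
  · refine ⟨0, fun m n h1 h2 h3 h4 h5 => trivial_bound ?_ m n h1 h2 h3 h4⟩
    have h6 : A * m ^ 2 + 1 * (B * n ^ 2) ≤ 8 * δ * (A * Y₁ ^ 2) :=
      (le_abs_self _).trans (h5.trans hδ)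
    have h7 : A * Y₁ ^ 2 ≤ A * m ^ 2 := by gcongr
    have h8 : 0 ≤ B * n ^ 2 := by positivity
    have h9 : 0 < A * Y₁ ^ 2 := by positivity
    by_contra hlt
    push Not at hlt
    nlinarith
  · refine ⟨Real.sqrt (B / A), fun m n h1 h2 h3 h4 h5 => ?_⟩
    have hm : 0 < m := hY₁.trans_le h1
    have hn : 0 < n := hY₂.trans_le h3
    have hθ : Real.sqrt (B / A) ^ 2 = B / A := Real.sq_sqrt (by positivity)
    set θ := Real.sqrt (B / A) with hθdef
    have hθ0 : 0 ≤ θ := Real.sqrt_nonneg _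
    have hB' : B = A * θ ^ 2 := by rw [hθ]; field_simp
    have hfac : A * m ^ 2 + -1 * (B * n ^ 2) = (m / n - θ) * (A * n ^ 2 * (m / n + θ)) := by
      rw [hB']; field_simp; ring
    have hp : 0 < A * n ^ 2 * (m / n + θ) := by positivity
    rw [hfac, abs_mul, abs_of_pos hp] at h5
    have h6 : |m / n - θ| * (A * n * m) ≤ 8 * δ * (A * Y₁ ^ 2) := by
      refine le_trans ?_ (h5.trans hδ)
      refine mul_le_mul_of_nonneg_left ?_ (abs_nonneg _)
      calc A * n * m = A * n ^ 2 * (m / n) := by field_simp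
        _ ≤ A * n ^ 2 * (m / n + θ) := by gcongr; linarith
    have hδ0 : 0 ≤ δ := by
      have : 0 ≤ |m / n - θ| * (A * n * m) := by positivity
      have h9 : 0 < A * Y₁ ^ 2 := by positivity
      by_contra hlt
      push Not at hlt
      nlinarith
    have h7 : |m / n - θ| * (A * Y₂ * Y₁) ≤ 8 * δ * (A * Y₁ ^ 2) := by
      refine le_trans ?_ h6
      gcongr
    rw [le_div_iff₀ hY₂]
    have h8 : (|m / n - θ| * Y₂) * (A * Y₁) ≤ (8 * δ * Y₁) * (A * Y₁) := by
      calc _ = |m / n - θ| * (A * Y₂ * Y₁) := by ring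
        _ ≤ _ := h7
        _ = _ := by ring
    have h9 := le_of_mul_le_mul_right h8 (by positivity)
    have : 0 ≤ δ * Y₁ := by positivity
    linarith

section Torsor

variable {ε : Fin 3 → ℤ} {s : Fin 3 → ℕ} {z w : (Fin 3 → ℕ) × (Fin 3 → ℕ)} {i j k : Fin 3}

/-- The residue class of `yᵢ / yⱼ` modulo `q`. -/
def slopeClass (q : ℕ) (i j : Fin 3) (z : (Fin 3 → ℕ) × (Fin 3 → ℕ)) : ℕ :=
  ((z.2 i : ZMod q) * (z.2 j : ZMod q)⁻¹).val

theorem dvd_slopeClass {q : ℕ} [NeZero q] (h : (z.2 j).Coprime q) :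
    (q : ℤ) ∣ (slopeClass q i j z : ℤ) * z.2 j - z.2 i := by
  rw [← ZMod.intCast_zmod_eq_zero_iff_dvd] 
  push_cast
  rw [slopeClass, ZMod.natCast_zmod_val, mul_assoc, mul_comm (_)⁻¹, ZMod.coe_mul_inv_eq_one _ h]
  simp

theorem card_torsorBox_fiber_le (F : Finset ((Fin 3 → ℕ) × (Fin 3 → ℕ))) {U Y : Fin 3 → ℕ}
    {a c : ℕ} (hε : ∀ i, IsUnit (ε i)) (hs : ∀ i, 0 < s i) (hU : ∀ i, 0 < U i)
    (hY : ∀ i, 0 < Y i) (hF : ∀ z ∈ F, InTorsorBox ε s U Y z)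
    (hij : i ≠ j) (hjk : j ≠ k) (hik : i ≠ k)
    (ha : ∀ z ∈ F, z.1 i = a) (hc : ∀ z ∈ F, z.2 k = c) {δ : ℝ} (hδ0 : 0 ≤ δ)
    (hδ : 1 ≤ δ ∨ (s k * U k * Y k ^ 2 : ℝ) ≤ δ * (s i * U i * Y i ^ 2)) :
    (F.card : ℝ) ≤ 2 * (U j + 2 * s k * Y k) * (1 + 128 * δ * Y i * Y j / (s k * Y k ^ 2)) := by
  classical
  rcases F.eq_empty_or_nonempty with rfl | ⟨z₀, hz₀⟩
  · simp only [Finset.card_empty, Nat.cast_zero]; positivity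
  have hcpos : 0 < c := hc z₀ hz₀ ▸ (hF z₀ hz₀).1.2.1 k
  have hc1 : Y k ≤ c := hc z₀ hz₀ ▸ ((hF z₀ hz₀).2 k).2.1
  have hc2 : c < 2 * Y k := hc z₀ hz₀ ▸ ((hF z₀ hz₀).2 k).2.2
  have ha1 : U i ≤ a := ha z₀ hz₀ ▸ ((hF z₀ hz₀).2 i).1.1
  set n := s k * c with hn
  have hnpos : 0 < n := Nat.mul_pos (hs k) hcpos
  have hq : s k * c ^ 2 = n * c := by rw [hn]; ring
  have : NeZero (n * c) := ⟨(Nat.mul_pos hnpos hcpos).ne'⟩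
  have hcop : ∀ z ∈ F, ∀ l, l ≠ k → (s l * z.1 l * z.2 l).Coprime (n * c) := by
    intro z hz l hl
    have := (hF z hz).1.coprime_term hl
    rwa [hc z hz, hq] at this
  have hclass : ∀ z ∈ F, ((n * c : ℕ) : ℤ) ∣ (slopeClass (n * c) i j z : ℤ) * z.2 j - z.2 i :=
    fun z hz => dvd_slopeClass ((hcop z hz j hjk).coprime_dvd_left ⟨s j * z.1 j, by ring⟩)
  set g : (Fin 3 → ℕ) × (Fin 3 → ℕ) → ℕ × ℕ := fun z => (z.1 j, slopeClass (n * c) i j z) with hg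
  have hR : (F.image g).card ≤ 2 * (U j + n) := by
    have hcopz := hcop z₀ hz₀
    apply card_square_class_pairs_le (F.image g) hnpos hcpos ⟨s k, by rw [hn]; ring⟩
      (a := ε i * ((s i * a : ℕ) : ℤ)) (b := ε j * (s j : ℤ))
    · rw [isCoprime_mul_unit_left_left (hε i), Nat.isCoprime_iff_coprime]
      have := hcopz i hik
      rw [ha z₀ hz₀] at this
      exact this.coprime_dvd_left ⟨z₀.2 i, by ring⟩
    · rw [isCoprime_mul_unit_left_left (hε j), Nat.isCoprime_iff_coprime]
      exact ((hcopz j hjk).coprime_dvd_left ⟨z₀.1 j * z₀.2 j, by ring⟩).coprime_dvd_right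
        ⟨c, rfl⟩
    · intro x hx
      obtain ⟨z, hz, rfl⟩ := Finset.mem_image.1 hx
      exact ((hF z hz).2 j).1
    · intro x hx
      obtain ⟨z, hz, rfl⟩ := Finset.mem_image.1 hx
      exact ZMod.val_lt _
    · intro x hx
      obtain ⟨z, hz, rfl⟩ := Finset.mem_image.1 hx
      have h1 : IsCoprime (z.2 i : ℤ) ((n * c : ℕ) : ℤ) :=
        Nat.isCoprime_iff_coprime.2 ((hcop z hz i hik).coprime_dvd_left ⟨s i * z.1 i, by ring⟩)
      obtain ⟨r, hr⟩ := hclass z hz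
      have h2 : (z.2 i : ℤ) = slopeClass (n * c) i j z * z.2 j + ((n * c : ℕ) : ℤ) * (-r) := by
        linear_combination -hr
      rw [h2] at h1
      have h3 : IsCoprime ((slopeClass (n * c) i j z : ℤ) * z.2 j) ((n * c : ℕ) : ℤ) :=
        IsCoprime.of_add_mul_left_left h1
      have h4 := Nat.isCoprime_iff_coprime.1 h3.of_mul_left_left
      exact h4.coprime_dvd_right ⟨n, by ring⟩
    · intro x hx
      obtain ⟨z, hz, rfl⟩ := Finset.mem_image.1 hx
      have d1 := (hF z hz).1.dvd hij hjk hik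
      rw [hc z hz, hq, ha z hz] at d1
      obtain ⟨r, hr⟩ := hclass z hz
      have h1 : IsCoprime ((n * c : ℕ) : ℤ) ((z.2 j : ℤ) ^ 2) := by
        have : IsCoprime (z.2 j : ℤ) ((n * c : ℕ) : ℤ) := Nat.isCoprime_iff_coprime.2
          ((hcop z hz j hjk).coprime_dvd_left ⟨s j * z.1 j, by ring⟩)
        exact this.symm.pow_right
      apply h1.dvd_of_dvd_mul_left
      have h2 : (z.2 i : ℤ) = slopeClass (n * c) i j z * z.2 j - ((n * c : ℕ) : ℤ) * r := by
        linear_combination -hr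
      rw [h2] at d1
      obtain ⟨r', hr'⟩ := d1
      refine ⟨r' + ε i * s i * a * (2 * slopeClass (n * c) i j z * z.2 j * r
        - ((n * c : ℕ) : ℤ) * r ^ 2), ?_⟩
      simp only [hg]
      push_cast at hr' ⊢
      linear_combination hr'
  have hYi : (0 : ℝ) < Y i := by exact_mod_cast hY i
  have hYj : (0 : ℝ) < Y j := by exact_mod_cast hY j
  have hYk : (0 : ℝ) < Y k := by exact_mod_cast hY k
  have hsk : (0 : ℝ) < s k := by exact_mod_cast hs k
  have hsi : (0 : ℝ) < s i := by exact_mod_cast hs i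
  have hsj : (0 : ℝ) < s j := by exact_mod_cast hs j
  have hcR : (Y k : ℝ) ≤ c := by exact_mod_cast hc1
  have hfib : ∀ b ∈ F.image g, ((F.filter fun z => g z = b).card : ℝ) ≤
      1 + 128 * δ * Y i * Y j / (s k * Y k ^ 2) := by
    intro b hb
    set G := F.filter fun z => g z = b with hG
    have hGF : ∀ z ∈ G, z ∈ F ∧ z.1 j = b.1 ∧ slopeClass (n * c) i j z = b.2 := by
      intro z hz
      obtain ⟨h1, h2⟩ := Finset.mem_filter.1 hz
      exact ⟨h1, by rw [← h2], by rw [← h2]⟩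
    obtain ⟨z₁, hz₁, hz₁b⟩ := Finset.mem_image.1 hb
    have hb1 : 0 < b.1 := by rw [← hz₁b]; exact (hF z₁ hz₁).1.1 j
    have hapos : 0 < a := (hU i).trans_le ha1
    have hinj : Set.InjOn (fun z : (Fin 3 → ℕ) × (Fin 3 → ℕ) => (z.2 i, z.2 j)) G := by
      intro z hz w hw h
      simp only [Prod.mk.injEq] at h
      obtain ⟨hzF, hzj, -⟩ := hGF z hz
      obtain ⟨hwF, hwj, -⟩ := hGF w hw
      refine (hF z hzF).1.ext (hF w hwF).1 (fun l => (hε l).ne_zero) hs hij hjk hik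
        ((ha z hzF).trans (ha w hwF).symm) (hzj.trans hwj.symm) (funext fun l => ?_)
      rcases fin_three_cases hij hjk hik l with rfl | rfl | rfl
      · exact h.1
      · exact h.2
      · exact (hc z hzF).trans (hc w hwF).symm
    rw [← Finset.card_image_of_injOn hinj]
    have hee : ((ε i * ε j : ℤ) : ℝ) = 1 ∨ ((ε i * ε j : ℤ) : ℝ) = -1 := by
      rcases Int.isUnit_iff.1 ((hε i).mul (hε j)) with h | h <;> rw [h] <;> simp
    obtain ⟨θ, hθ⟩ := exists_slope_near (A := s i * a) (B := s j * b.1)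
      (K := 8 * (s k * U k * Y k ^ 2)) (Y₁ := Y i) (Y₂ := Y j) (δ := δ)
      (by positivity) (by positivity) hYi hYj hee (by
        refine hδ.imp id fun h => ?_
        have h' : (U i : ℝ) ≤ a := by exact_mod_cast ha1
        calc 8 * (s k * U k * Y k ^ 2 : ℝ) ≤ 8 * (δ * (s i * U i * Y i ^ 2)) := by gcongr
          _ ≤ 8 * (δ * (s i * a * Y i ^ 2)) := by gcongr
          _ = _ := by ring)
    have key := card_le_of_slopes_separated
      (G.image (fun z : (Fin 3 → ℕ) × (Fin 3 → ℕ) => (z.2 i, z.2 j)))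
      (N := Y j) (q := s k * Y k ^ 2) (θ := θ) (η := 16 * δ * Y i / Y j) (by positivity) hYj
      (by positivity) ?_ ?_ ?_
    · refine key.trans (le_of_eq ?_)
      field_simp
      ring
    · intro x hx
      obtain ⟨z, hz, rfl⟩ := Finset.mem_image.1 hx
      have := ((hF z (hGF z hz).1).2 j).2
      exact ⟨by exact_mod_cast this.1, by exact_mod_cast this.2⟩
    · intro x hx
      obtain ⟨z, hz, rfl⟩ := Finset.mem_image.1 hx
      obtain ⟨hzF, hzj, -⟩ := hGF z hz
      have hbox := hF z hzF
      have b1 := (hbox.2 i).2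
      have b2 := (hbox.2 j).2
      have b3 := (hbox.2 k).1
      have b4 := (hbox.2 k).2
      apply hθ
      · exact_mod_cast b1.1
      · exact_mod_cast b1.2
      · exact_mod_cast b2.1
      · exact_mod_cast b2.2
      have hsum := hbox.1.sum_eq hij hjk hik
      have hεi2 : ε i * ε i = 1 := by
        rcases Int.isUnit_iff.1 (hε i) with h | h <;> rw [h] <;> norm_num
      have hsumZ : (s i * a : ℤ) * (z.2 i : ℤ) ^ 2
          + (ε i * ε j) * ((s j * b.1 : ℤ) * (z.2 j : ℤ) ^ 2)
          = -(ε i * ε k) * ((s k : ℤ) * z.1 k * (z.2 k : ℤ) ^ 2) := by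
        rw [← ha z hzF, ← hzj]
        linear_combination ε i * hsum - (s i * z.1 i : ℤ) * (z.2 i : ℤ) ^ 2 * hεi2
      have hsumR : (s i * a : ℝ) * (z.2 i : ℝ) ^ 2
          + ((ε i * ε j : ℤ) : ℝ) * ((s j * b.1 : ℝ) * (z.2 j : ℝ) ^ 2)
          = ((-(ε i * ε k) : ℤ) : ℝ) * ((s k : ℝ) * z.1 k * (z.2 k : ℝ) ^ 2) := by
        exact_mod_cast hsumZ
      rw [hsumR, abs_mul]
      have hu : |((-(ε i * ε k) : ℤ) : ℝ)| = 1 := by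
        rcases Int.isUnit_iff.1 ((hε i).mul (hε k)) with h | h <;> rw [h] <;> simp
      rw [hu, one_mul, abs_of_nonneg (by positivity)]
      have c1 : (z.1 k : ℝ) ≤ 2 * U k := by exact_mod_cast b3.2.le
      have c2 : (z.2 k : ℝ) ≤ 2 * Y k := by exact_mod_cast b4.2.le
      calc (s k : ℝ) * z.1 k * (z.2 k : ℝ) ^ 2 ≤ s k * (2 * U k) * (2 * Y k) ^ 2 := by gcongr
        _ = _ := by ring
    · intro x hx x' hx' hne
      obtain ⟨z, hz, rfl⟩ := Finset.mem_image.1 hx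
      obtain ⟨w, hw, rfl⟩ := Finset.mem_image.1 hx'
      obtain ⟨hzF, -, hzt⟩ := hGF z hz
      obtain ⟨hwF, -, hwt⟩ := hGF w hw
      have hdvd : ((n * c : ℕ) : ℤ) ∣ (z.2 i : ℤ) * w.2 j - w.2 i * z.2 j := by
        have d1 := hclass z hzF
        have d2 := hclass w hwF
        rw [hzt] at d1
        rw [hwt] at d2
        have e : (z.2 i : ℤ) * w.2 j - w.2 i * z.2 j = (b.2 * w.2 j - w.2 i) * z.2 j
            - (b.2 * z.2 j - z.2 i) * w.2 j := by ring
        rw [e]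
        exact dvd_sub (d2.mul_right _) (d1.mul_right _)
      refine le_trans ?_ (le_abs_cross_of_dvd ((hF z hzF).1.coprime_y hij)
        ((hF w hwF).1.coprime_y hij) hne hdvd)
      rw [← hq]
      push_cast
      gcongr
  have h1 := card_le_card_mul_of_fibers F g (F.image g) (fun z hz => Finset.mem_image_of_mem g hz)
    hfib
  refine h1.trans ?_
  gcongr
  have h2 : ((F.image g).card : ℝ) ≤ 2 * (U j + n) := by exact_mod_cast hR
  have h3 : (n : ℝ) ≤ 2 * s k * Y k := by
    have : (c : ℝ) ≤ 2 * Y k := by exact_mod_cast hc2.le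
    calc (n : ℝ) = s k * c := by rw [hn]; push_cast; ring
      _ ≤ s k * (2 * Y k) := by gcongr
      _ = _ := by ring
  linarith

theorem card_torsorBox_le_of_classes (S : Finset ((Fin 3 → ℕ) × (Fin 3 → ℕ))) {U Y : Fin 3 → ℕ}
    (hε : ∀ i, IsUnit (ε i)) (hs : ∀ i, 0 < s i) (hU : ∀ i, 0 < U i)
    (hY : ∀ i, 0 < Y i) (hS : ∀ z ∈ S, InTorsorBox ε s U Y z)
    (hij : i ≠ j) (hjk : j ≠ k) (hik : i ≠ k) {δ : ℝ} (hδ0 : 0 ≤ δ)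
    (hδ : 1 ≤ δ ∨ (s k * U k * Y k ^ 2 : ℝ) ≤ δ * (s i * U i * Y i ^ 2)) :
    (S.card : ℝ) ≤ (U i * Y k) *
      (2 * (U j + 2 * s k * Y k) * (1 + 128 * δ * Y i * Y j / (s k * Y k ^ 2))) := by
  classical
  have hT : ((Finset.Ico (U i) (2 * U i) ×ˢ Finset.Ico (Y k) (2 * Y k)).card : ℝ) = U i * Y k := by
    simp only [Finset.card_product, Nat.card_Ico, two_mul, Nat.add_sub_cancel]
    push_cast; ring
  rw [← hT]
  refine card_le_card_mul_of_fibers S (fun z => (z.1 i, z.2 k)) _ ?_ ?_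
  · intro z hz
    simp only [Finset.mem_product, Finset.mem_Ico]
    exact ⟨((hS z hz).2 i).1, ((hS z hz).2 k).2⟩
  · intro b _
    refine card_torsorBox_fiber_le (a := b.1) (c := b.2) _ hε hs hU hY
      (fun z hz => hS z (Finset.mem_filter.1 hz).1) hij hjk hik ?_ ?_ hδ0 hδ
    · intro z hz
      rw [← (Finset.mem_filter.1 hz).2]
    · intro z hz
      rw [← (Finset.mem_filter.1 hz).2]

end Torsor

theorem exponents_le_of_fixed_y {x ζ σ₁ σ₂ σ₃ p₁ p₂ p₃ q₁ q₂ q₃ α₁ α₂ α₃ G₁ G₂ : ℝ}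
    (e₁ : α₁ = x - σ₁ - p₁ - 2 * q₁) (e₂ : α₂ = x - σ₂ - p₂ - 2 * q₂)
    (e₃ : α₃ = x - σ₃ - p₃ - 2 * q₃) (h₁ : 0 ≤ α₁) (h₂ : 0 ≤ α₂) (h₃ : 0 ≤ α₃)
    (h₃₁ : α₃ ≤ α₁) (h₃₂ : α₃ ≤ α₂) (hw : p₁ + p₂ + p₃ ≤ ζ)
    (hyw : q₁ + q₂ + q₃ ≤ p₁ + p₂ + p₃)
    (hG₁ : G₁ = (x + ζ - (σ₁ + σ₂ + σ₃)) / 2 - (ζ - (p₁ + p₂ + p₃)) / 24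
      - (α₁ + α₂ + α₃) / 24)
    (hG₂ : G₂ = x - (p₁ + p₂ + p₃ - (q₁ + q₂ + q₃)) / 24 - (α₁ + α₂ + α₃) / 24)
    (hσ : 0 ≤ σ₁ + σ₂ + σ₃) :
    q₁ + q₂ + q₃ ≤ G₂ ∧ q₁ + q₂ + q₃ + p₁ + p₂ - σ₃ - 2 * q₃ ≤ G₁ := by
  constructor <;> linarith

theorem exponents_le_of_classes {x ζ σ₁ σ₂ σ₃ p₁ p₂ p₃ q₁ q₂ q₃ α₁ α₂ α₃ G₁ G₃ : ℝ}
    (e₁ : α₁ = x - σ₁ - p₁ - 2 * q₁) (e₂ : α₂ = x - σ₂ - p₂ - 2 * q₂)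
    (e₃ : α₃ = x - σ₃ - p₃ - 2 * q₃) (h₁ : 0 ≤ α₁) (h₂ : 0 ≤ α₂)
    (k₁ : α₂ - 4 ≤ α₁ ∨ α₃ - 4 ≤ α₁) (k₂ : α₁ - 4 ≤ α₂ ∨ α₃ - 4 ≤ α₂)
    (k₃ : α₁ - 4 ≤ α₃ ∨ α₂ - 4 ≤ α₃)
    (hw : p₁ + p₂ + p₃ ≤ ζ) (hyw : p₁ + p₂ + p₃ ≤ q₁ + q₂ + q₃)
    (hσ₁ : 0 ≤ σ₁) (hσ₂ : 0 ≤ σ₂) (hσ₃ : 0 ≤ σ₃)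
    (h31 : q₃ + σ₃ / 2 ≤ q₁ + σ₁ / 2) (h12 : q₁ + σ₁ / 2 ≤ q₂ + σ₂ / 2)
    (hG₁ : G₁ = (x + ζ - (σ₁ + σ₂ + σ₃)) / 2 - (ζ - (p₁ + p₂ + p₃)) / 24
      - (α₁ + α₂ + α₃) / 24)
    (hG₃ : G₃ = x - (q₂ + σ₂ / 2 - (q₁ + σ₁ / 2)) / 24 - (α₁ + α₂ + α₃) / 24) :
    (p₁ + p₂ + q₃ ≤ G₃ + 16 ∧ p₁ + σ₃ + 2 * q₃ ≤ G₃ + 16 ∧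
      0 + p₁ + p₂ + q₁ + q₂ - σ₃ - q₃ ≤ G₁ + 16 ∧ 0 + p₁ + q₁ + q₂ ≤ G₃ + 16) ∨
    (p₂ + p₁ + q₃ ≤ G₃ + 16 ∧ p₂ + σ₃ + 2 * q₃ ≤ G₃ + 16 ∧
      0 + p₂ + p₁ + q₂ + q₁ - σ₃ - q₃ ≤ G₁ + 16 ∧ 0 + p₂ + q₂ + q₁ ≤ G₃ + 16) ∨
    (p₂ + p₁ + q₃ ≤ G₃ + 16 ∧ p₂ + σ₃ + 2 * q₃ ≤ G₃ + 16 ∧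
      (α₂ - α₃) + p₂ + p₁ + q₂ + q₁ - σ₃ - q₃ ≤ G₁ + 16 ∧
      (α₂ - α₃) + p₂ + q₂ + q₁ ≤ G₃ + 16) ∨
    (p₃ + p₂ + q₁ ≤ G₃ + 16 ∧ p₃ + σ₁ + 2 * q₁ ≤ G₃ + 16 ∧
      0 + p₃ + p₂ + q₃ + q₂ - σ₁ - q₁ ≤ G₁ + 16 ∧ 0 + p₃ + q₃ + q₂ ≤ G₃ + 16) := by
  obtain rfl : p₁ = x - σ₁ - 2 * q₁ - α₁ := by linarith
  obtain rfl : p₂ = x - σ₂ - 2 * q₂ - α₂ := by linarith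
  obtain rfl : p₃ = x - σ₃ - 2 * q₃ - α₃ := by linarith
  by_cases hI : α₃ ≤ α₁ + 8 ∧ α₃ ≤ α₂ + 8
  · obtain ⟨hI₁, hI₂⟩ := hI
    rcases le_total α₁ α₂ with hα | hα
    · right; left
      rcases k₃ with k₃ | k₃ <;> refine ⟨?_, ?_, ?_, ?_⟩ <;> linarith
    · rcases le_total (q₂ + σ₂ / 2 - (q₁ + σ₁ / 2)) (α₁ / 2) with hD | hD
      · left
        rcases k₃ with k₃ | k₃ <;> refine ⟨?_, ?_, ?_, ?_⟩ <;> linarith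
      · right; left
        rcases k₃ with k₃ | k₃ <;> refine ⟨?_, ?_, ?_, ?_⟩ <;> linarith
  · have hII : α₂ ≤ α₁ + 4 ∧ α₁ ≤ α₂ + 4 ∧ α₁ + 4 ≤ α₃ ∧ α₂ + 4 ≤ α₃ := by
      rw [not_and_or, not_le, not_le] at hI
      rcases hI with hI | hI <;> rcases k₁ with k₁ | k₁ <;> rcases k₂ with k₂ | k₂ <;>
        refine ⟨?_, ?_, ?_, ?_⟩ <;> linarith
    obtain ⟨a1, a2, a3, a4⟩ := hII
    rcases le_total (α₃ - α₁)
      (2 * (q₁ + σ₁ / 2 + (q₂ + σ₂ / 2) - 2 * (q₃ + σ₃ / 2))) with hD | hD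
    · right; right; left
      refine ⟨?_, ?_, ?_, ?_⟩ <;> linarith
    · right; right; right
      refine ⟨?_, ?_, ?_, ?_⟩ <;> linarith

theorem exists_sorted_fin_three (f : Fin 3 → ℝ) :
    ∃ i j k : Fin 3, i ≠ j ∧ j ≠ k ∧ i ≠ k ∧ f i ≤ f j ∧ f j ≤ f k := by
  have hm := Tuple.monotone_sort f
  exact ⟨Tuple.sort f 0, Tuple.sort f 1, Tuple.sort f 2, by simp, by simp, by simp,
    hm (by decide), hm (by decide)⟩

section DyadicBox

variable {ε : Fin 3 → ℤ} {s : Fin 3 → ℕ} {i j k : Fin 3}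

theorem two_rpow_natCast_cast (n : ℕ) : (((2 ^ n : ℕ) : ℕ) : ℝ) = (2 : ℝ) ^ (n : ℝ) := by
  rw [Real.rpow_natCast]; push_cast; rfl

theorem IsTorsorPoint.le_add {z : (Fin 3 → ℕ) × (Fin 3 → ℕ)} (hz : IsTorsorPoint ε s z)
    (hε : ∀ i, IsUnit (ε i)) (hij : i ≠ j) (hjk : j ≠ k) (hik : i ≠ k) :
    s i * z.1 i * z.2 i ^ 2 ≤ s j * z.1 j * z.2 j ^ 2 + s k * z.1 k * z.2 k ^ 2 := by
  have h := hz.sum_eq hij hjk hik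
  zify
  have a1 : (0 : ℤ) ≤ s i * z.1 i * z.2 i ^ 2 := by positivity
  have a2 : (0 : ℤ) ≤ s j * z.1 j * z.2 j ^ 2 := by positivity
  have a3 : (0 : ℤ) ≤ s k * z.1 k * z.2 k ^ 2 := by positivity
  rcases Int.isUnit_iff.1 (hε i) with e1 | e1 <;> rcases Int.isUnit_iff.1 (hε j) with e2 | e2 <;>
    rcases Int.isUnit_iff.1 (hε k) with e3 | e3 <;> rw [e1, e2, e3] at h <;> linarith

theorem exponents_comparable {z : (Fin 3 → ℕ) × (Fin 3 → ℕ)} {p q : Fin 3 → ℕ} {σ : Fin 3 → ℝ}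
    {x : ℝ} (hσ : ∀ i, (s i : ℝ) = 2 ^ σ i) (hε : ∀ i, IsUnit (ε i))
    (hz : InTorsorBox ε s (fun i => 2 ^ p i) (fun i => 2 ^ q i) z)
    (hij : i ≠ j) (hjk : j ≠ k) (hik : i ≠ k) :
    x - σ j - p j - 2 * q j - 4 ≤ x - σ i - p i - 2 * q i ∨
      x - σ k - p k - 2 * q k - 4 ≤ x - σ i - p i - 2 * q i := by
  have hlow : ∀ l, (2 : ℝ) ^ (σ l + p l + 2 * q l) ≤ s l * z.1 l * (z.2 l : ℝ) ^ 2 := by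
    intro l
    have b1 : ((2 : ℝ) ^ (p l : ℝ)) ≤ z.1 l := by
      rw [← two_rpow_natCast_cast]; exact_mod_cast (hz.2 l).1.1
    have b2 : ((2 : ℝ) ^ (q l : ℝ)) ≤ z.2 l := by
      rw [← two_rpow_natCast_cast]; exact_mod_cast (hz.2 l).2.1
    rw [Real.rpow_add two_pos, Real.rpow_add two_pos, hσ l, mul_comm (2 : ℝ) (q l : ℝ),
      Real.rpow_mul two_pos.le, Real.rpow_two]
    gcongr
  have hup : ∀ l, s l * z.1 l * (z.2 l : ℝ) ^ 2 < 2 ^ (σ l + p l + 2 * q l + 3) := by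
    intro l
    have b1 : (z.1 l : ℝ) < 2 * 2 ^ (p l : ℝ) := by
      rw [← two_rpow_natCast_cast]; exact_mod_cast (hz.2 l).1.2
    have b2 : (z.2 l : ℝ) ≤ 2 * 2 ^ (q l : ℝ) := by
      rw [← two_rpow_natCast_cast]; exact_mod_cast (hz.2 l).2.2.le
    have hs : (0 : ℝ) < s l := by rw [hσ]; positivity
    have hz2 : (0 : ℝ) < z.2 l := by exact_mod_cast hz.1.2.1 l
    rw [Real.rpow_add two_pos, Real.rpow_add two_pos, Real.rpow_add two_pos, ← hσ l,
      mul_comm (2 : ℝ) (q l : ℝ), Real.rpow_mul two_pos.le, Real.rpow_two]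
    calc (s l : ℝ) * z.1 l * (z.2 l : ℝ) ^ 2 < s l * (2 * 2 ^ (p l : ℝ)) * (z.2 l : ℝ) ^ 2 := by gcongr
      _ ≤ (s l : ℝ) * (2 * 2 ^ (p l : ℝ)) * (2 * 2 ^ (q l : ℝ)) ^ 2 := by gcongr
      _ = _ := by norm_num; ring
  have hsum : (s i * z.1 i * (z.2 i : ℝ) ^ 2)
      ≤ s j * z.1 j * (z.2 j : ℝ) ^ 2 + s k * z.1 k * (z.2 k : ℝ) ^ 2 := by
    exact_mod_cast hz.1.le_add hε hij hjk hik
  by_contra hcon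
  rw [not_or, not_le, not_le] at hcon
  have key : ∀ l, x - σ i - p i - 2 * q i < x - σ l - p l - 2 * q l - 4 →
      2 * (s l * z.1 l * (z.2 l : ℝ) ^ 2) < s i * z.1 i * (z.2 i : ℝ) ^ 2 := by
    intro l hl
    refine lt_of_lt_of_le ?_ (hlow i)
    calc 2 * (s l * z.1 l * (z.2 l : ℝ) ^ 2) < 2 * 2 ^ (σ l + p l + 2 * q l + 3) := by
          gcongr; exact hup l
      _ = 2 ^ (σ l + p l + 2 * q l + 3 + 1) := by
          rw [Real.rpow_add two_pos _ 1, Real.rpow_one, mul_comm]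
      _ ≤ _ := by
          apply Real.rpow_le_rpow_of_exponent_le one_le_two; linarith
  linarith [key j hcon.1, key k hcon.2]

theorem card_dyadicBox_le_of_fixed_y (S : Finset ((Fin 3 → ℕ) × (Fin 3 → ℕ))) {p q : Fin 3 → ℕ}
    {σ : Fin 3 → ℝ} (hσ : ∀ i, (s i : ℝ) = 2 ^ σ i) (hε : ∀ i, IsUnit (ε i))
    (hS : ∀ z ∈ S, InTorsorBox ε s (fun i => 2 ^ p i) (fun i => 2 ^ q i) z)
    (hij : i ≠ j) (hjk : j ≠ k) (hik : i ≠ k) {e₁ e₂ : ℝ} (h₁ : (q i + q j + q k : ℝ) ≤ e₁)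
    (h₂ : q i + q j + q k + p i + p j - σ k - 2 * q k ≤ e₂) :
    (S.card : ℝ) ≤ 16 * (2 ^ e₁ + 2 ^ e₂) := by
  have hs : ∀ i, 0 < s i := fun i => by
    have : (0 : ℝ) < s i := by rw [hσ]; positivity
    exact_mod_cast this
  refine (card_torsorBox_le_of_fixed_y S hε hs (fun i => by positivity) (fun i => by positivity)
    hS hij hjk hik).trans ?_
  have m1 := Real.rpow_le_rpow_of_exponent_le one_le_two h₁
  have m2 := Real.rpow_le_rpow_of_exponent_le one_le_two h₂
  simp only [two_rpow_natCast_cast]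
  rw [hσ k]
  have t1 : (2 : ℝ) ^ (q i : ℝ) * 2 ^ (q j : ℝ) * 2 ^ (q k : ℝ) = 2 ^ (q i + q j + q k : ℝ) := by
    simp only [Real.rpow_add two_pos]
  have t2 : (2 : ℝ) ^ (q i : ℝ) * 2 ^ (q j : ℝ) * 2 ^ (q k : ℝ) *
      (2 ^ (p i : ℝ) * 2 ^ (p j : ℝ) / (2 ^ σ k * (2 ^ (q k : ℝ)) ^ 2)) =
      2 ^ (q i + q j + q k + p i + p j - σ k - 2 * q k) := by
    simp only [Real.rpow_add two_pos, Real.rpow_sub two_pos, mul_comm (2 : ℝ) (q k : ℝ),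
      Real.rpow_mul two_pos.le, Real.rpow_two]
    field_simp
  have : (2 : ℝ) ^ (q i : ℝ) * 2 ^ (q j : ℝ) * 2 ^ (q k : ℝ) *
      (1 + 16 * 2 ^ (p i : ℝ) * 2 ^ (p j : ℝ) / (2 ^ σ k * (2 ^ (q k : ℝ)) ^ 2)) =
      2 ^ (q i + q j + q k : ℝ) + 16 * 2 ^ (q i + q j + q k + p i + p j - σ k - 2 * q k) := by
    rw [← t1, ← t2]; ring
  rw [this]
  have : (0 : ℝ) < 2 ^ e₁ := by positivity
  linarith

theorem card_dyadicBox_le_of_classes (S : Finset ((Fin 3 → ℕ) × (Fin 3 → ℕ))) {p q : Fin 3 → ℕ}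
    {σ : Fin 3 → ℝ} (hσ : ∀ i, (s i : ℝ) = 2 ^ σ i) (hε : ∀ i, IsUnit (ε i))
    (hS : ∀ z ∈ S, InTorsorBox ε s (fun i => 2 ^ p i) (fun i => 2 ^ q i) z)
    (hij : i ≠ j) (hjk : j ≠ k) (hik : i ≠ k) {d e₁ e₂ : ℝ}
    (hd : 0 ≤ d ∨ σ k + p k + 2 * q k ≤ d + (σ i + p i + 2 * q i))
    (h₁ : (p i + p j + q k : ℝ) ≤ e₁) (h₂ : p i + σ k + 2 * q k ≤ e₁)
    (h₃ : d + p i + p j + q i + q j - σ k - q k ≤ e₂) (h₄ : d + p i + q i + q j ≤ e₁) :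
    (S.card : ℝ) ≤ 1024 * (2 ^ e₁ + 2 ^ e₂) := by
  have hs : ∀ i, 0 < s i := fun i => by
    have : (0 : ℝ) < s i := by rw [hσ]; positivity
    exact_mod_cast this
  have hsq : ∀ l, (2 : ℝ) ^ (2 * (q l : ℝ)) = (2 ^ (q l : ℝ)) ^ 2 := fun l => by
    rw [mul_comm (2 : ℝ) (q l : ℝ), Real.rpow_mul two_pos.le, Real.rpow_two]
  refine (card_torsorBox_le_of_classes S hε hs (fun i => by positivity) (fun i => by positivity)
    hS hij hjk hik (δ := 2 ^ d) (by positivity) ?_).trans ?_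
  · rcases hd with hd | hd
    · exact Or.inl (Real.one_le_rpow one_le_two hd)
    · right
      have := Real.rpow_le_rpow_of_exponent_le one_le_two hd
      simpa only [two_rpow_natCast_cast, hσ, Real.rpow_add two_pos, hsq] using this
  have m1 := Real.rpow_le_rpow_of_exponent_le one_le_two h₁
  have m2 := Real.rpow_le_rpow_of_exponent_le one_le_two h₂
  have m3 := Real.rpow_le_rpow_of_exponent_le one_le_two h₃
  have m4 := Real.rpow_le_rpow_of_exponent_le one_le_two h₄
  simp only [two_rpow_natCast_cast]
  rw [hσ k]
  simp only [Real.rpow_add two_pos, Real.rpow_sub two_pos, hsq] at m1 m2 m3 m4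
  have : (2 : ℝ) ^ (p i : ℝ) * 2 ^ (q k : ℝ) * (2 * (2 ^ (p j : ℝ) + 2 * 2 ^ σ k * 2 ^ (q k : ℝ)) *
      (1 + 128 * 2 ^ d * 2 ^ (q i : ℝ) * 2 ^ (q j : ℝ) / (2 ^ σ k * (2 ^ (q k : ℝ)) ^ 2))) =
      2 * (2 ^ (p i : ℝ) * 2 ^ (p j : ℝ) * 2 ^ (q k : ℝ)) +
      4 * (2 ^ (p i : ℝ) * 2 ^ σ k * (2 ^ (q k : ℝ)) ^ 2) +
      256 * (2 ^ d * 2 ^ (p i : ℝ) * 2 ^ (p j : ℝ) * 2 ^ (q i : ℝ) * 2 ^ (q j : ℝ) / 2 ^ σ k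
        / 2 ^ (q k : ℝ)) + 512 * (2 ^ d * 2 ^ (p i : ℝ) * 2 ^ (q i : ℝ) * 2 ^ (q j : ℝ)) := by
    field_simp
    ring
  rw [this]
  have : (0 : ℝ) < 2 ^ e₁ := by positivity
  have : (0 : ℝ) < 2 ^ e₂ := by positivity
  linarith

theorem rpow_le_sum_cyclic (f : Fin 3 → Fin 3 → ℝ) (hf : ∀ i j, f i j = f j i) (hij : i ≠ j) :
    (2 : ℝ) ^ f i j ≤ ∑ l, (2 : ℝ) ^ f l (l + 1) := by
  have h : j = i + 1 ∨ i = j + 1 := by revert i j; decide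
  rcases h with rfl | rfl
  · exact Finset.single_le_sum (f := fun l => (2 : ℝ) ^ f l (l + 1)) (fun l _ => by positivity)
      (Finset.mem_univ i)
  · rw [hf]
    exact Finset.single_le_sum (f := fun l => (2 : ℝ) ^ f l (l + 1)) (fun l _ => by positivity)
      (Finset.mem_univ j)

theorem card_dyadicBox_le (S : Finset ((Fin 3 → ℕ) × (Fin 3 → ℕ))) {p q : Fin 3 → ℕ}
    {σ α : Fin 3 → ℝ} {x ζ w y : ℝ} (hσ : ∀ i, (s i : ℝ) = 2 ^ σ i) (hε : ∀ i, IsUnit (ε i))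
    (hS : ∀ z ∈ S, InTorsorBox ε s (fun i => 2 ^ p i) (fun i => 2 ^ q i) z)
    (hα : ∀ i, α i = x - σ i - p i - 2 * q i) (hα0 : ∀ i, 0 ≤ α i) (hσ0 : ∀ i, 0 ≤ σ i)
    (hw : w = ∑ i, (p i : ℝ)) (hy : y = ∑ i, (q i : ℝ)) (hwζ : w ≤ ζ) :
    (S.card : ℝ) ≤ 2 ^ 30 *
      (2 ^ ((x + ζ - ∑ i, σ i) / 2 - |ζ - w| / 24 - (∑ i, α i) / 24) +
        2 ^ (x - |w - y| / 24 - (∑ i, α i) / 24) +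
        ∑ i, 2 ^ (x - |q i + σ i / 2 - (q (i + 1) + σ (i + 1) / 2)| / 24 - (∑ i, α i) / 24)) := by
  set G₁ := (x + ζ - ∑ i, σ i) / 2 - |ζ - w| / 24 - (∑ i, α i) / 24 with hG₁
  set G₂ := x - |w - y| / 24 - (∑ i, α i) / 24 with hG₂
  set g : Fin 3 → Fin 3 → ℝ := fun i j =>
    x - |q i + σ i / 2 - (q j + σ j / 2)| / 24 - (∑ i, α i) / 24 with hg
  change (S.card : ℝ) ≤ 2 ^ 30 * (2 ^ G₁ + 2 ^ G₂ + ∑ i, 2 ^ g i (i + 1))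
  have P₁ : (0 : ℝ) < 2 ^ G₁ := by positivity
  have P₂ : (0 : ℝ) < 2 ^ G₂ := by positivity
  have P₃ : (0 : ℝ) ≤ ∑ i, 2 ^ g i (i + 1) := by positivity
  rcases S.eq_empty_or_nonempty with rfl | ⟨z, hz⟩
  · rw [Finset.card_empty, Nat.cast_zero]; positivity
  rw [abs_of_nonneg (by linarith)] at hG₁
  rcases le_total y w with hyw | hyw
  · rw [abs_of_nonneg (by linarith)] at hG₂
    obtain ⟨k, i, j, hki, hij, hkj, h1, h2⟩ := exists_sorted_fin_three α
    rw [fin_three_sum hij hkj.symm hki.symm] at hw hy hG₁ hG₂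
    rw [fin_three_sum hij hkj.symm hki.symm] at hG₁
    obtain ⟨b1, b2⟩ := exponents_le_of_fixed_y (ζ := ζ) (G₁ := G₁) (G₂ := G₂) (hα i) (hα j) (hα k)
      (hα0 i) (hα0 j) (hα0 k) h1 (h1.trans h2) (by linarith) (by linarith) (by rw [hG₁, hw])
      (by rw [hG₂, hw, hy]) (by linarith [hσ0 i, hσ0 j, hσ0 k])
    have := card_dyadicBox_le_of_fixed_y S hσ hε hS hij hkj.symm hki.symm b1 b2
    linarith
  · obtain ⟨k, i, j, hki, hij, hkj, h1, h2⟩ := exists_sorted_fin_three fun i => q i + σ i / 2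
    have hgs : (2 : ℝ) ^ g i j ≤ ∑ l, (2 : ℝ) ^ g l (l + 1) :=
      rpow_le_sum_cyclic g (fun a b => by simp only [hg]; rw [abs_sub_comm]) hij
    have hgij : g i j = x - (q j + σ j / 2 - (q i + σ i / 2)) / 24 - (α i + α j + α k) / 24 := by
      simp only [hg]
      rw [abs_sub_comm, abs_of_nonneg (by linarith), fin_three_sum hij hkj.symm hki.symm]
    rw [fin_three_sum hij hkj.symm hki.symm] at hw hy hG₁
    rw [fin_three_sum hij hkj.symm hki.symm] at hG₁
    have comp : ∀ {a b c : Fin 3}, a ≠ b → b ≠ c → a ≠ c → α b - 4 ≤ α a ∨ α c - 4 ≤ α a := by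
      intro a b c hab hbc hac
      simp only [hα]
      exact exponents_comparable hσ hε (hS z hz) hab hbc hac
    have main := exponents_le_of_classes (ζ := ζ) (G₁ := G₁) (G₃ := g i j) (hα i) (hα j) (hα k)
      (hα0 i) (hα0 j) (comp hij hkj.symm hki.symm) (comp hij.symm hki.symm hkj.symm)
      (comp hki hij hkj) (by linarith) (by linarith)
      (hσ0 i) (hσ0 j) (hσ0 k) h1 h2 (by rw [hG₁, hw]) hgij
    have fin : ∀ {a b c : Fin 3} {d : ℝ}, a ≠ b → b ≠ c → a ≠ c →
        (0 ≤ d ∨ σ c + p c + 2 * q c ≤ d + (σ a + p a + 2 * q a)) →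
        (p a + p b + q c ≤ g i j + 16 ∧ p a + σ c + 2 * q c ≤ g i j + 16 ∧
        d + p a + p b + q a + q b - σ c - q c ≤ G₁ + 16 ∧ d + p a + q a + q b ≤ g i j + 16) →
        (S.card : ℝ) ≤ 2 ^ 30 * (2 ^ G₁ + 2 ^ G₂ + ∑ i, 2 ^ g i (i + 1)) := by
      rintro a b c d hab hbc hac hd ⟨c1, c2, c3, c4⟩
      have := card_dyadicBox_le_of_classes S hσ hε hS hab hbc hac hd c1 c2 c3 c4
      rw [Real.rpow_add two_pos, Real.rpow_add two_pos] at this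
      norm_num at this ⊢
      linarith
    rcases main with h | h | h | h
    · exact fin hij hkj.symm hki.symm (Or.inl le_rfl) h
    · exact fin hij.symm hki.symm hkj.symm (Or.inl le_rfl) h
    · exact fin hij.symm hki.symm hkj.symm (Or.inr (by linarith [hα j, hα k])) h
    · exact fin hkj hij.symm hki (Or.inl le_rfl) h

end DyadicBox

theorem exists_forall_sum_rpow_neg_abs_le :
    ∃ K : ℝ, 0 ≤ K ∧ ∀ T : Finset ℤ, ∑ l ∈ T, (2 : ℝ) ^ (-|(l : ℝ)| / 24) ≤ K := by
  have hsum : Summable fun l : ℤ => (2 : ℝ) ^ (-|(l : ℝ)| / 24) := by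
    have hr : Summable fun n : ℕ => ((2 : ℝ) ^ (-1 / 24 : ℝ)) ^ n :=
      summable_geometric_of_lt_one (by positivity)
        (Real.rpow_lt_one_of_one_lt_of_neg one_lt_two (by norm_num))
    have h : ∀ n : ℕ, ((2 : ℝ) ^ (-1 / 24 : ℝ)) ^ n = (2 : ℝ) ^ (-(n : ℝ) / 24) := fun n => by
      rw [← Real.rpow_natCast, ← Real.rpow_mul two_pos.le]; congr 1; ring
    simp only [h] at hr
    refine Summable.of_nat_of_neg ?_ ?_ <;> simpa using hr
  exact ⟨_, tsum_nonneg fun l => by positivity, fun T =>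
    hsum.sum_le_tsum T fun l _ => by positivity⟩

theorem sum_rpow_neg_abs_le_of_injOn {ι : Type*} {K : ℝ}
    (hK : ∀ T : Finset ℤ, ∑ l ∈ T, (2 : ℝ) ^ (-|(l : ℝ)| / 24) ≤ K) (F : Finset ι) {N : ℕ}
    (a : ι → Fin 3 → ℤ) (c : ι → ℤ) (n m : ι → ℕ) (hn : ∀ z ∈ F, n z ≤ N) (hm : ∀ z ∈ F, m z ≤ N)
    (hinj : Set.InjOn (fun z => (a z, c z, n z, m z)) F) :
    ∑ z ∈ F, (∏ i, (2 : ℝ) ^ (-|(a z i : ℝ)| / 24)) * 2 ^ (-|(c z : ℝ)| / 24)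
      ≤ K ^ 4 * ((N : ℝ) + 1) ^ 2 := by
  classical
  set W : ℤ → ℝ := fun l => (2 : ℝ) ^ (-|(l : ℝ)| / 24) with hW
  have hW0 : ∀ l, 0 ≤ W l := fun l => by positivity
  set Q : Finset ((Fin 3 → ℤ) × ℤ × ℕ × ℕ) :=
    (Fintype.piFinset fun i => F.image fun z => a z i) ×ˢ F.image c ×ˢ
      Finset.range (N + 1) ×ˢ Finset.range (N + 1) with hQ
  set h : (Fin 3 → ℤ) × ℤ × ℕ × ℕ → ℝ := fun t => (∏ i, W (t.1 i)) * W t.2.1 with hh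
  have h0 : ∀ t, 0 ≤ h t := fun t =>
    mul_nonneg (Finset.prod_nonneg fun i _ => hW0 _) (hW0 _)
  calc ∑ z ∈ F, (∏ i, W (a z i)) * W (c z)
      = ∑ t ∈ F.image (fun z => (a z, c z, n z, m z)), h t := by
        rw [Finset.sum_image hinj]
    _ ≤ ∑ t ∈ Q, h t := by
        refine Finset.sum_le_sum_of_subset_of_nonneg ?_ fun t _ _ => h0 t
        intro t ht
        obtain ⟨z, hz, rfl⟩ := Finset.mem_image.1 ht
        simp only [hQ, Finset.mem_product, Fintype.mem_piFinset, Finset.mem_range,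
          Nat.lt_succ_iff]
        exact ⟨fun i => Finset.mem_image_of_mem _ hz, Finset.mem_image_of_mem _ hz, hn z hz,
          hm z hz⟩
    _ = (∏ i, ∑ l ∈ F.image (fun z => a z i), W l) * (∑ l ∈ F.image c, W l) *
          ((N : ℝ) + 1) ^ 2 := by
        rw [Finset.prod_univ_sum, hQ, Finset.sum_product, Finset.sum_mul, Finset.sum_mul]
        refine Finset.sum_congr rfl fun f _ => ?_
        rw [Finset.sum_product, Finset.mul_sum, Finset.sum_mul]
        refine Finset.sum_congr rfl fun l _ => ?_
        simp only [hh, Finset.sum_const, Finset.card_product, Finset.card_range, nsmul_eq_mul]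
        push_cast; ring
    _ ≤ (∏ _i : Fin 3, K) * K * ((N : ℝ) + 1) ^ 2 := by
        have hs : ∀ T : Finset ℤ, 0 ≤ ∑ l ∈ T, W l := fun T => Finset.sum_nonneg fun l _ => hW0 l
        gcongr
        · exact Finset.prod_nonneg fun i _ => (hs ∅).trans (hK ∅)
        · exact hK _
        · exact hK _
    _ = _ := by simp only [Finset.prod_const, Finset.card_univ, Fintype.card_fin]; ring

theorem abs_floor_sub_le (t : ℝ) (n : ℤ) : |((⌊t⌋ - n : ℤ) : ℝ)| ≤ |t - n| + 1 := by
  have h1 := Int.floor_le t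
  have h2 := Int.lt_floor_add_one t
  push_cast
  rw [abs_le]
  constructor
  · linarith [neg_abs_le (t - n)]
  · linarith [le_abs_self (t - n)]

/-- Sums of exponentially decaying weights over a family of dyadic boxes in which two of the
exponents are free. -/
theorem sum_rpow_sub_le_of_injOn {ι : Type*} {K : ℝ}
    (hK : ∀ T : Finset ℤ, ∑ l ∈ T, (2 : ℝ) ^ (-|(l : ℝ)| / 24) ≤ K) (F : Finset ι) {N : ℕ}
    {τ : Fin 3 → ℝ} {A t : ℝ} {α : ι → Fin 3 → ℝ} {g : ι → ℝ} (a : ι → Fin 3 → ℤ) (c : ι → ℤ)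
    (n m : ι → ℕ) (hα : ∀ z ∈ F, ∀ i, α z i = |τ i - a z i|) (hg : ∀ z ∈ F, g z = |t - c z|)
    (hn : ∀ z ∈ F, n z ≤ N) (hm : ∀ z ∈ F, m z ≤ N)
    (hinj : ∀ z ∈ F, ∀ w ∈ F, a z = a w → c z = c w → n z = n w → m z = m w → z = w) :
    ∑ z ∈ F, (2 : ℝ) ^ (A - g z / 24 - (∑ i, α z i) / 24)
      ≤ 2 ^ A * (2 * (K ^ 4 * ((N : ℝ) + 1) ^ 2)) := by
  have key := sum_rpow_neg_abs_le_of_injOn hK F (fun z i => ⌊τ i⌋ - a z i) (fun z => ⌊t⌋ - c z)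
    n m hn hm (by
      intro z hz w hw h
      simp only [Prod.mk.injEq] at h
      refine hinj z hz w hw (funext fun i => ?_) (by linarith [h.2.1]) h.2.2.1 h.2.2.2
      linarith [congrFun h.1 i])
  refine le_trans ?_ (mul_le_mul_of_nonneg_left (mul_le_mul_of_nonneg_left key two_pos.le)
    (by positivity))
  rw [Finset.mul_sum, Finset.mul_sum]
  refine Finset.sum_le_sum fun z hz => ?_
  have : (2 : ℝ) ^ A * (2 * ((∏ i, (2 : ℝ) ^ (-|((⌊τ i⌋ - a z i : ℤ) : ℝ)| / 24)) *
      2 ^ (-|((⌊t⌋ - c z : ℤ) : ℝ)| / 24))) =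
      2 ^ (A + 1 + (-|((⌊τ 0⌋ - a z 0 : ℤ) : ℝ)| / 24 + -|((⌊τ 1⌋ - a z 1 : ℤ) : ℝ)| / 24
        + -|((⌊τ 2⌋ - a z 2 : ℤ) : ℝ)| / 24) + -|((⌊t⌋ - c z : ℤ) : ℝ)| / 24) := by
    rw [Fin.prod_univ_three]
    simp only [Real.rpow_add two_pos, Real.rpow_one]
    ring
  rw [this]
  apply Real.rpow_le_rpow_of_exponent_le one_le_two
  rw [Fin.sum_univ_three, hα z hz, hα z hz, hα z hz, hg z hz]
  linarith [abs_floor_sub_le (τ 0) (a z 0), abs_floor_sub_le (τ 1) (a z 1),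
    abs_floor_sub_le (τ 2) (a z 2), abs_floor_sub_le t (c z)]

theorem two_rpow_logb {t : ℝ} (ht : 0 < t) : (2 : ℝ) ^ Real.logb 2 t = t :=
  Real.rpow_logb two_pos (by norm_num) ht

theorem sum_natCast_le_of_prod_le {v : Fin 3 → ℕ} (hv : ∀ i, 0 < v i) {Z : ℝ}
    (h : ((∏ i, v i : ℕ) : ℝ) ≤ Z) : ∑ i, (Nat.log 2 (v i) : ℝ) ≤ Real.logb 2 Z := by
  have hp : (0 : ℝ) < (∏ i, v i : ℕ) := by
    exact_mod_cast Finset.prod_pos fun i _ => hv i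
  rw [Real.le_logb_iff_rpow_le one_lt_two (hp.trans_le h)]
  refine le_trans ?_ h
  rw [Fin.sum_univ_three, Fin.prod_univ_three, Real.rpow_add two_pos, Real.rpow_add two_pos]
  simp only [Real.rpow_natCast]
  exact_mod_cast Nat.mul_le_mul (Nat.mul_le_mul (Nat.pow_log_le_self 2 (hv 0).ne')
    (Nat.pow_log_le_self 2 (hv 1).ne')) (Nat.pow_log_le_self 2 (hv 2).ne')

/-- Torsor points with bounded terms `sᵢ vᵢ yᵢ²` and bounded product `v₁ v₂ v₃`. -/
theorem exists_card_torsorPoints_le :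
    ∃ K : ℝ, 0 ≤ K ∧ ∀ (N : ℕ) (ε : Fin 3 → ℤ) (s : Fin 3 → ℕ) (X Z : ℝ)
      (S : Finset ((Fin 3 → ℕ) × (Fin 3 → ℕ))), (∀ i, IsUnit (ε i)) → (∀ i, 0 < s i) →
      0 ≤ X → X ≤ 2 ^ N →
      (∀ z ∈ S, IsTorsorPoint ε s z ∧ (∀ i, ((s i * z.1 i * z.2 i ^ 2 : ℕ) : ℝ) ≤ X) ∧
        ((∏ i, z.1 i : ℕ) : ℝ) ≤ Z) →
      (S.card : ℝ) ≤ K * (X + √(X * Z / ∏ i, (s i : ℝ))) * ((N : ℝ) + 1) ^ 2 := by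
  obtain ⟨K, hK0, hK⟩ := exists_forall_sum_rpow_neg_abs_le
  refine ⟨2 ^ 33 * K ^ 4, by positivity, ?_⟩
  intro N ε s X Z S hε hs hX0 hXN hS
  rcases S.eq_empty_or_nonempty with rfl | ⟨z₀, hz₀⟩
  · rw [Finset.card_empty, Nat.cast_zero]; positivity
  have hterm : ∀ z ∈ S, ∀ i, 1 ≤ s i * z.1 i * z.2 i ^ 2 := fun z hz i =>
    Nat.succ_le_of_lt (Nat.mul_pos (Nat.mul_pos (hs i) ((hS z hz).1.1 i))
      (pow_pos ((hS z hz).1.2.1 i) 2))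
  have hX : 0 < X := by
    refine lt_of_lt_of_le one_pos (le_trans ?_ ((hS z₀ hz₀).2.1 0))
    exact_mod_cast hterm z₀ hz₀ 0
  have hZ : 0 < Z := by
    refine lt_of_lt_of_le ?_ (hS z₀ hz₀).2.2
    exact_mod_cast Finset.prod_pos fun i _ => (hS z₀ hz₀).1.1 i
  set x := Real.logb 2 X with hx
  set ζ := Real.logb 2 Z with hζ
  set σ : Fin 3 → ℝ := fun i => Real.logb 2 (s i) with hσd
  have hsR : ∀ i, (0 : ℝ) < s i := fun i => by exact_mod_cast hs i
  have hσ : ∀ i, (s i : ℝ) = 2 ^ σ i := fun i => (two_rpow_logb (hsR i)).symm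
  have hσ0 : ∀ i, 0 ≤ σ i := fun i =>
    Real.logb_nonneg one_lt_two (by exact_mod_cast Nat.succ_le_of_lt (hs i))
  set φ : (Fin 3 → ℕ) × (Fin 3 → ℕ) → (Fin 3 → ℕ) × (Fin 3 → ℕ) := fun z =>
    (fun i => Nat.log 2 (z.1 i), fun i => Nat.log 2 (z.2 i)) with hφ
  set F := S.image φ with hF
  set α : (Fin 3 → ℕ) × (Fin 3 → ℕ) → Fin 3 → ℝ := fun b i => x - σ i - b.1 i - 2 * b.2 i with hα
  have hFα : ∀ b ∈ F, ∀ i, 0 ≤ α b i := by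
    intro b hb i
    obtain ⟨z, hz, rfl⟩ := Finset.mem_image.1 hb
    have h1 : σ i + (Nat.log 2 (z.1 i) : ℝ) + 2 * (Nat.log 2 (z.2 i) : ℝ) ≤ x := by
      rw [hx, Real.le_logb_iff_rpow_le one_lt_two hX]
      refine le_trans ?_ ((hS z hz).2.1 i)
      rw [Real.rpow_add two_pos, Real.rpow_add two_pos, ← hσ, mul_comm (2 : ℝ) (Nat.log 2 _ : ℝ),
        Real.rpow_mul two_pos.le, Real.rpow_two]
      simp only [Real.rpow_natCast]
      exact_mod_cast Nat.mul_le_mul (Nat.mul_le_mul le_rfl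
        (Nat.pow_log_le_self 2 ((hS z hz).1.1 i).ne'))
        (Nat.pow_le_pow_left (Nat.pow_log_le_self 2 ((hS z hz).1.2.1 i).ne') 2)
    simp only [hα, hφ]
    linarith
  have hFN : ∀ b ∈ F, ∀ i, b.2 i ≤ N := by
    intro b hb i
    have h1 := hFα b hb i
    have h2 : x ≤ N := by
      rw [hx, Real.logb_le_iff_le_rpow one_lt_two hX, Real.rpow_natCast]; exact hXN
    have h3 : (b.2 i : ℝ) ≤ N := by
      have h4 := hσ0 i
      have h5 : (0 : ℝ) ≤ b.1 i := Nat.cast_nonneg _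
      have h6 : (0 : ℝ) ≤ b.2 i := Nat.cast_nonneg _
      simp only [hα] at h1
      linarith
    exact_mod_cast h3
  have hFw : ∀ b ∈ F, ∑ i, (b.1 i : ℝ) ≤ ζ := by
    intro b hb
    obtain ⟨z, hz, rfl⟩ := Finset.mem_image.1 hb
    exact sum_natCast_le_of_prod_le (hS z hz).1.1 (hS z hz).2.2
  have hfib : ∀ b ∈ F, ((S.filter fun z => φ z = b).card : ℝ) ≤ 2 ^ 30 *
      (2 ^ ((x + ζ - ∑ i, σ i) / 2 - |ζ - ∑ i, (b.1 i : ℝ)| / 24 - (∑ i, α b i) / 24) +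
        2 ^ (x - |∑ i, (b.1 i : ℝ) - ∑ i, (b.2 i : ℝ)| / 24 - (∑ i, α b i) / 24) +
        ∑ i, 2 ^ (x - |b.2 i + σ i / 2 - (b.2 (i + 1) + σ (i + 1) / 2)| / 24
          - (∑ i, α b i) / 24)) := by
    intro b hb
    refine card_dyadicBox_le _ hσ hε ?_ (fun i => rfl) (hFα b hb) hσ0 rfl rfl (hFw b hb)
    intro z hz
    obtain ⟨hzS, rfl⟩ := Finset.mem_filter.1 hz
    refine ⟨(hS z hzS).1, fun i => ⟨⟨Nat.pow_log_le_self 2 ((hS z hzS).1.1 i).ne', ?_⟩,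
      Nat.pow_log_le_self 2 ((hS z hzS).1.2.1 i).ne', ?_⟩⟩
    · have := Nat.lt_pow_succ_log_self one_lt_two (z.1 i)
      rwa [pow_succ'] at this
    · have := Nat.lt_pow_succ_log_self one_lt_two (z.2 i)
      rwa [pow_succ'] at this
  have hab : ∀ b ∈ F, ∀ i, α b i = |(x - σ i) - ((b.1 i + 2 * b.2 i : ℤ) : ℝ)| := by
    intro b hb i
    have : (x - σ i) - ((b.1 i + 2 * b.2 i : ℤ) : ℝ) = α b i := by
      simp only [hα]; push_cast; ring
    rw [this, abs_of_nonneg (hFα b hb i)]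
  have S1 := sum_rpow_sub_le_of_injOn hK F (A := (x + ζ - ∑ i, σ i) / 2) (τ := fun i => x - σ i)
    (t := ζ) (g := fun b => |ζ - ∑ i, (b.1 i : ℝ)|) (fun b i => (b.1 i + 2 * b.2 i : ℤ))
    (fun b => ∑ i, (b.1 i : ℤ)) (fun b => b.2 0) (fun b => b.2 1) hab
    (fun b _ => by push_cast; rfl) (fun b hb => hFN b hb 0) (fun b hb => hFN b hb 1) (by
      intro b _ b' _ h1 h2 h3 h4
      have e0 := congrFun h1 0
      have e1 := congrFun h1 1
      have e2 := congrFun h1 2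
      simp only [Fin.sum_univ_three] at h2 e0 e1 e2
      ext l <;> fin_cases l <;> simp only [Fin.zero_eta, Fin.mk_one, Fin.reduceFinMk] <;> omega)
  have S2 := sum_rpow_sub_le_of_injOn hK F (A := x) (τ := fun i => x - σ i)
    (t := 0) (g := fun b => |∑ i, (b.1 i : ℝ) - ∑ i, (b.2 i : ℝ)|)
    (fun b i => (b.1 i + 2 * b.2 i : ℤ))
    (fun b => ∑ i, (b.2 i : ℤ) - ∑ i, (b.1 i : ℤ)) (fun b => b.2 0) (fun b => b.2 1) hab
    (fun b _ => by push_cast; congr 1; ring) (fun b hb => hFN b hb 0) (fun b hb => hFN b hb 1) (by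
      intro b _ b' _ h1 h2 h3 h4
      have e0 := congrFun h1 0
      have e1 := congrFun h1 1
      have e2 := congrFun h1 2
      simp only [Fin.sum_univ_three] at h2 e0 e1 e2
      ext l <;> fin_cases l <;> simp only [Fin.zero_eta, Fin.mk_one, Fin.reduceFinMk] <;> omega)
  have S3 := fun i : Fin 3 => sum_rpow_sub_le_of_injOn hK F (A := x) (τ := fun i => x - σ i)
    (t := σ i / 2 - σ (i + 1) / 2)
    (g := fun b => |b.2 i + σ i / 2 - (b.2 (i + 1) + σ (i + 1) / 2)|)
    (fun b i => (b.1 i + 2 * b.2 i : ℤ))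
    (fun b => (b.2 (i + 1) : ℤ) - b.2 i) (fun b => b.2 i) (fun b => b.2 (i + 2)) hab
    (fun b _ => by push_cast; congr 1; ring) (fun b hb => hFN b hb i)
    (fun b hb => hFN b hb (i + 2)) (by
      intro b _ b' _ h1 h2 h3 h4
      have e0 := congrFun h1 0
      have e1 := congrFun h1 1
      have e2 := congrFun h1 2
      ext l <;> fin_cases l <;> fin_cases i <;>
        simp only [Fin.zero_eta, Fin.mk_one, Fin.reduceFinMk, Fin.reduceAdd, Fin.isValue] at * <;>
        omega)
  have hcard : (S.card : ℝ) ≤ ∑ b ∈ F, 2 ^ 30 *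
      (2 ^ ((x + ζ - ∑ i, σ i) / 2 - |ζ - ∑ i, (b.1 i : ℝ)| / 24 - (∑ i, α b i) / 24) +
        2 ^ (x - |∑ i, (b.1 i : ℝ) - ∑ i, (b.2 i : ℝ)| / 24 - (∑ i, α b i) / 24) +
        ∑ i, 2 ^ (x - |b.2 i + σ i / 2 - (b.2 (i + 1) + σ (i + 1) / 2)| / 24
          - (∑ i, α b i) / 24)) := by
    rw [Finset.card_eq_sum_card_fiberwise (f := φ) (t := F)
      (fun z hz => Finset.mem_image_of_mem φ hz)]
    push_cast
    exact Finset.sum_le_sum hfib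
  rw [← Finset.mul_sum, Finset.sum_add_distrib, Finset.sum_add_distrib, Finset.sum_comm] at hcard
  have S3' := Finset.sum_le_sum fun i (_ : i ∈ Finset.univ) => S3 i
  rw [Finset.sum_const, Finset.card_univ, Fintype.card_fin, nsmul_eq_mul] at S3'
  have hXx : (2 : ℝ) ^ x = X := two_rpow_logb hX
  have hsqrt : (2 : ℝ) ^ ((x + ζ - ∑ i, σ i) / 2) = √(X * Z / ∏ i, (s i : ℝ)) := by
    rw [Real.sqrt_eq_rpow, div_eq_mul_one_div (x + ζ - ∑ i, σ i) 2, Real.rpow_mul two_pos.le]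
    congr 1
    rw [Real.rpow_sub two_pos, Real.rpow_add two_pos, hXx, two_rpow_logb hZ, Fin.sum_univ_three,
      Fin.prod_univ_three, hσ 0, hσ 1, hσ 2, Real.rpow_add two_pos, Real.rpow_add two_pos]
  rw [hsqrt] at S1
  rw [hXx] at S2 S3'
  refine hcard.trans ?_
  have hP : 0 ≤ √(X * Z / ∏ i, (s i : ℝ)) * (K ^ 4 * ((N : ℝ) + 1) ^ 2) := by positivity
  have hP' : 0 ≤ X * (K ^ 4 * ((N : ℝ) + 1) ^ 2) := by positivity
  push_cast at S3'
  calc _ ≤ (2 : ℝ) ^ 30 * (√(X * Z / ∏ i, (s i : ℝ)) * (2 * (K ^ 4 * ((N : ℝ) + 1) ^ 2)) +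
        X * (2 * (K ^ 4 * ((N : ℝ) + 1) ^ 2)) + 3 * (X * (2 * (K ^ 4 * ((N : ℝ) + 1) ^ 2)))) := by
        gcongr
    _ ≤ _ := by
        norm_num
        linarith

theorem exists_factorization_of_cube_mul_eq_sq {g y : ℕ} {β : Fin 3 → ℕ} (hg : 0 < g)
    (hβ : ∀ i, 0 < β i) (hcop : ∀ i j, i ≠ j → Nat.Coprime (β i) (β j))
    (h : g ^ 3 * ∏ i, β i = y ^ 2) :
    ∃ (e : ℕ) (s t : Fin 3 → ℕ), (∀ i, β i = s i * t i ^ 2) ∧ g = e ^ 2 * ∏ i, s i ∧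
      y = e ^ 3 * (∏ i, s i) ^ 2 * ∏ i, t i := by
  choose t s hst hsq using fun i => Nat.sq_mul_squarefree (β i)
  have hst' : ∀ i, β i = t i * s i ^ 2 := fun i => by rw [← hst i, mul_comm]
  have hs : ∀ i j, i ≠ j → Nat.Coprime (t i) (t j) := fun i j hij =>
    Nat.Coprime.coprime_dvd_left ⟨_, hst' i⟩ (Nat.Coprime.coprime_dvd_right ⟨_, hst' j⟩
      (hcop i j hij))
  have ht0 : ∀ i, 0 < s i := fun i => by
    rcases Nat.eq_zero_or_pos (s i) with h0 | h0
    · exact absurd (hst' i) (by rw [h0]; simpa using (hβ i).ne')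
    · exact h0
  have hS : Squarefree (∏ i, t i) := by
    rw [Fin.prod_univ_three, Nat.squarefree_mul, Nat.squarefree_mul (hs 0 1 (by decide))]
    · exact ⟨⟨hsq 0, hsq 1⟩, hsq 2⟩
    · exact Nat.Coprime.mul_left (hs 0 2 (by decide)) (hs 1 2 (by decide))
  have hprod : ∏ i, β i = (∏ i, t i) * (∏ i, s i) ^ 2 := by
    simp only [hst', Finset.prod_mul_distrib, Finset.prod_pow]
  have hT : 0 < ∏ i, s i := Finset.prod_pos fun i _ => ht0 i
  set S := ∏ i, t i with hSdef
  set T := ∏ i, s i with hTdef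
  rw [hprod] at h
  obtain ⟨m, rfl⟩ : T ∣ y := (Nat.pow_dvd_pow_iff two_ne_zero).1 ⟨g ^ 3 * S, by rw [← h]; ring⟩
  have h1 : g ^ 3 * S = m ^ 2 := Nat.eq_of_mul_eq_mul_right (pow_pos hT 2) (by linarith)
  obtain ⟨n, rfl⟩ : g ∣ m := (Nat.pow_dvd_pow_iff two_ne_zero).1 ⟨g * S, by rw [← h1]; ring⟩
  have h2 : g * S = n ^ 2 := Nat.eq_of_mul_eq_mul_right (pow_pos hg 2) (by linarith)
  obtain ⟨e, rfl⟩ : S ∣ n := (hS.dvd_pow_iff_dvd two_ne_zero).1 ⟨g, by rw [← h2]; ring⟩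
  have h3 : g = e ^ 2 * S := Nat.eq_of_mul_eq_mul_right (Nat.pos_of_ne_zero hS.ne_zero)
    (by linarith)
  refine ⟨e, t, s, hst', h3, ?_⟩
  rw [← hSdef, ← hTdef]
  nth_rewrite 1 [h3]
  ring

/-- Positive solutions of `A₀ A₁ A₂ = w y²` whose pairwise greatest common divisors agree lift to
the universal torsor. -/
theorem exists_torsor_coordinates {A : Fin 3 → ℕ} {d w y : ℕ} (hA : ∀ i, 0 < A i) (hw : 0 < w)
    (hd : ∀ i j, i ≠ j → Nat.gcd (A i) (A j) = d)
    (hprim : ∀ f, f ∣ d → f ∣ w → Nat.Coprime f y) (h : ∏ i, A i = w * y ^ 2) :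
    ∃ (f e : ℕ) (s v t : Fin 3 → ℕ), 0 < f ∧ 0 < e ∧ (∀ i, 0 < s i) ∧ (∀ i, 0 < v i) ∧
      (∀ i, 0 < t i) ∧ (∀ i, A i = f * e ^ 2 * (∏ i, s i) * (s i * v i * t i ^ 2)) ∧
      w = f ^ 3 * ∏ i, v i ∧ y = e ^ 3 * (∏ i, s i) ^ 2 * ∏ i, t i ∧
      ∀ i j, i ≠ j → Nat.Coprime (s i * v i * t i) (s j * v j * t j) := by
  have hd0 : 0 < d := by rw [← hd 0 1 (by decide)]; exact Nat.gcd_pos_of_pos_left _ (hA 0)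
  have hdA : ∀ i, d ∣ A i := fun i => by
    rw [← hd i (i + 1) (by revert i; decide)]; exact Nat.gcd_dvd_left _ _
  choose A' hA' using hdA
  have hcop : ∀ i j, i ≠ j → Nat.Coprime (A' i) (A' j) := fun i j hij => by
    have := hd i j hij
    rw [hA' i, hA' j, Nat.gcd_mul_left] at this
    exact Nat.eq_of_mul_eq_mul_left hd0 (by rw [this, mul_one])
  set f := Nat.gcd d w with hf
  have hf0 : 0 < f := Nat.gcd_pos_of_pos_left _ hd0
  obtain ⟨g, hg⟩ : f ∣ d := Nat.gcd_dvd_left _ _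
  have hg0 : 0 < g := Nat.pos_of_ne_zero fun h0 => by rw [h0, mul_zero] at hg; omega
  have hprod : ∏ i, A i = d ^ 3 * ∏ i, A' i := by
    simp only [hA', Finset.prod_mul_distrib, Finset.prod_const, Finset.card_univ,
      Fintype.card_fin]
  rw [hprod] at h
  have hfy : Nat.Coprime f y := hprim f (Nat.gcd_dvd_left _ _) (Nat.gcd_dvd_right _ _)
  obtain ⟨w', hw'⟩ : f ^ 3 ∣ w := by
    refine Nat.Coprime.dvd_of_dvd_mul_right (Nat.Coprime.pow 3 2 hfy) ⟨g ^ 3 * ∏ i, A' i, ?_⟩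
    rw [← h, hg]; ring
  have hgw : Nat.Coprime g w' := by
    have h1 : f * Nat.gcd g (f ^ 2 * w') = f * 1 := by
      rw [← Nat.gcd_mul_left, ← hg, mul_one, ← mul_assoc, ← pow_succ', ← hw']
    exact Nat.Coprime.coprime_dvd_right (Dvd.intro_left _ rfl)
      (Nat.eq_of_mul_eq_mul_left hf0 h1)
  have hw0 : 0 < w' := Nat.pos_of_ne_zero fun h0 => by rw [h0, mul_zero] at hw'; omega
  have h1 : g ^ 3 * ∏ i, A' i = w' * y ^ 2 := by
    refine Nat.eq_of_mul_eq_mul_left (pow_pos hf0 3) ?_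
    calc f ^ 3 * (g ^ 3 * ∏ i, A' i) = (f * g) ^ 3 * ∏ i, A' i := by ring
      _ = f ^ 3 * (w' * y ^ 2) := by rw [← hg, h]; nth_rewrite 1 [hw']; ring
  have hwA : w' ∣ ∏ i, A' i :=
    Nat.Coprime.dvd_of_dvd_mul_left (Nat.Coprime.pow_left 3 hgw).symm ⟨_, h1⟩
  set v : Fin 3 → ℕ := fun i => Nat.gcd w' (A' i) with hv
  have hv0 : ∀ i, 0 < v i := fun i => Nat.gcd_pos_of_pos_left _ hw0
  have hwv : w' = ∏ i, v i := by
    rw [Fin.prod_univ_three] at hwA ⊢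
    simp only [hv]
    rw [← Nat.Coprime.gcd_mul _ (hcop 0 1 (by decide)), ← Nat.Coprime.gcd_mul _
      (Nat.Coprime.mul_left (hcop 0 2 (by decide)) (hcop 1 2 (by decide))),
      Nat.gcd_eq_left hwA]
  choose β hβ using fun i => (Nat.gcd_dvd_right w' (A' i) : v i ∣ A' i)
  have hA'0 : ∀ i, 0 < A' i := fun i => Nat.pos_of_ne_zero fun h0 => by
    have := hA i; rw [hA' i, h0] at this; simp at this
  have hβ0 : ∀ i, 0 < β i := fun i => Nat.pos_of_ne_zero fun h0 => by
    have := hA'0 i; rw [hβ i, h0] at this; simp at this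
  have hβcop : ∀ i j, i ≠ j → Nat.Coprime (β i) (β j) := fun i j hij =>
    Nat.Coprime.coprime_dvd_left (Dvd.intro_left _ (hβ i).symm)
      (Nat.Coprime.coprime_dvd_right (Dvd.intro_left _ (hβ j).symm) (hcop i j hij))
  have h2 : g ^ 3 * ∏ i, β i = y ^ 2 := by
    refine Nat.eq_of_mul_eq_mul_left hw0 ?_
    have h3 : ∏ i, A' i = (∏ i, v i) * ∏ i, β i := by
      rw [← Finset.prod_mul_distrib]
      exact Finset.prod_congr rfl fun i _ => hβ i
    rw [← h1, h3, ← hwv]; ring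
  obtain ⟨e, s, t, hst, hge, hye⟩ := exists_factorization_of_cube_mul_eq_sq hg0 hβ0 hβcop h2
  refine ⟨f, e, s, v, t, hf0, ?_, ?_, hv0, ?_, ?_, ?_, hye, ?_⟩
  · exact Nat.pos_of_ne_zero fun h0 => by rw [h0] at hge; simp at hge; omega
  · exact fun i => Nat.pos_of_ne_zero fun h0 => by
      have := hβ0 i; rw [hst i, h0] at this; simp at this
  · exact fun i => Nat.pos_of_ne_zero fun h0 => by
      have := hβ0 i; rw [hst i, h0] at this; simp at this
  · intro i
    rw [hA' i, hg, hβ i, hst i]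
    nth_rewrite 1 [hge]
    ring
  · rw [← hwv, ← hw']
  · intro i j hij
    have hdvd : ∀ l, s l * v l * t l ∣ A' l := fun l => ⟨t l, by rw [hβ l, hst l]; ring⟩
    exact Nat.Coprime.coprime_dvd_left (hdvd i) (Nat.Coprime.coprime_dvd_right (hdvd j)
      (hcop i j hij))

theorem exists_torsorPoint_of_solution {x : Fin 4 → ℤ}
    (hgcd : Finset.gcd Finset.univ (fun i => (x i).natAbs) = 1)
    (heq : x 0 * x 1 * (x 0 + x 1) + x 3 * (x 0 + x 1 + x 2) ^ 2 = 0)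
    (hne : x 3 * (x 0 + x 1 + x 2) ≠ 0) :
    ∃ (f e : ℕ) (s : Fin 3 → ℕ) (ε : Fin 3 → ℤ) (η : ℤ) (z : (Fin 3 → ℕ) × (Fin 3 → ℕ)),
      0 < f ∧ 0 < e ∧ (∀ i, 0 < s i) ∧ (∀ i, IsUnit (ε i)) ∧ IsUnit η ∧ IsTorsorPoint ε s z ∧
      (∀ i, (![x 0, x 1, -(x 0 + x 1)] : Fin 3 → ℤ) i
        = ε i * ((f * e ^ 2 * (∏ i, s i) * (s i * z.1 i * z.2 i ^ 2) : ℕ) : ℤ)) ∧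
      x 3 = (∏ i, ε i) * ((f ^ 3 * ∏ i, z.1 i : ℕ) : ℤ) ∧
      x 0 + x 1 + x 2 = η * ((e ^ 3 * (∏ i, s i) ^ 2 * ∏ i, z.2 i : ℕ) : ℤ) := by
  set a : Fin 3 → ℤ := ![x 0, x 1, -(x 0 + x 1)] with ha
  set y := x 0 + x 1 + x 2 with hy
  have hw0 : x 3 ≠ 0 := left_ne_zero_of_mul hne
  have hy0 : y ≠ 0 := right_ne_zero_of_mul hne
  have hprod : ∏ i, a i = x 3 * y ^ 2 := by
    rw [Fin.prod_univ_three]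
    simp only [ha, Matrix.cons_val]
    linear_combination -heq
  have ha0 : ∀ i, a i ≠ 0 := by
    have : ∏ i, a i ≠ 0 := by rw [hprod]; exact mul_ne_zero hw0 (pow_ne_zero 2 hy0)
    exact fun i => Finset.prod_ne_zero_iff.1 this i (Finset.mem_univ i)
  have hsum : ∑ i, a i = 0 := by
    rw [Fin.sum_univ_three]
    simp only [ha, Matrix.cons_val]
    ring
  have hprodN : ∏ i, (a i).natAbs = (x 3).natAbs * y.natAbs ^ 2 := by
    have := congrArg Int.natAbs hprod
    rw [Int.natAbs_mul, Int.natAbs_pow] at this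
    rw [← this]
    exact (map_prod Int.natAbsHom _ _).symm
  have hd : ∀ i j, i ≠ j → Nat.gcd (a i).natAbs (a j).natAbs = Int.gcd (x 0) (x 1) := by
    have g1 : Int.gcd (x 0) (-(x 0 + x 1)) = Int.gcd (x 0) (x 1) := by simp
    have g2 : Int.gcd (x 1) (-(x 0 + x 1)) = Int.gcd (x 0) (x 1) := by
      rw [Int.gcd_comm (x 0)]; simp
    intro i j hij
    change Int.gcd (a i) (a j) = _
    fin_cases i <;> fin_cases j <;> simp only [ne_eq, not_true_eq_false] at hij <;>
      first
        | exact absurd rfl hij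
        | rfl
        | exact g1
        | exact g2
        | exact Int.gcd_comm _ _
        | exact (Int.gcd_comm _ _).trans g1
        | exact (Int.gcd_comm _ _).trans g2
  have hprim : ∀ f, f ∣ Int.gcd (x 0) (x 1) → f ∣ (x 3).natAbs → Nat.Coprime f y.natAbs := by
    intro f hf hf3
    have h0 : (f : ℤ) ∣ x 0 := (Int.natCast_dvd_natCast.2 hf).trans (Int.gcd_dvd_left _ _)
    have h1 : (f : ℤ) ∣ x 1 := (Int.natCast_dvd_natCast.2 hf).trans (Int.gcd_dvd_right _ _)
    have h3 : (f : ℤ) ∣ x 3 := Int.natCast_dvd.2 hf3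
    have hg : ((Nat.gcd f y.natAbs : ℕ) : ℤ) ∣ f :=
      Int.natCast_dvd_natCast.2 (Nat.gcd_dvd_left _ _)
    have hgy : ((Nat.gcd f y.natAbs : ℕ) : ℤ) ∣ y := Int.natCast_dvd.2 (Nat.gcd_dvd_right _ _)
    have h2 : ((Nat.gcd f y.natAbs : ℕ) : ℤ) ∣ x 2 := by
      have : x 2 = y - x 0 - x 1 := by rw [hy]; ring
      rw [this]
      exact dvd_sub (dvd_sub hgy (hg.trans h0)) (hg.trans h1)
    have : Nat.gcd f y.natAbs ∣ Finset.gcd Finset.univ (fun i => (x i).natAbs) := by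
      refine Finset.dvd_gcd fun i _ => Int.natCast_dvd.1 ?_
      fin_cases i
      · exact hg.trans h0
      · exact hg.trans h1
      · exact h2
      · exact hg.trans h3
    rw [hgcd] at this
    exact Nat.dvd_one.1 this
  obtain ⟨f, e, s, v, t, hf, he, hs, hv, ht, hA, hW, hY, hcop⟩ :=
    exists_torsor_coordinates (fun i => Int.natAbs_pos.2 (ha0 i)) (Int.natAbs_pos.2 hw0) hd hprim
      hprodN
  have hsign : ∀ i, a i = (a i).sign *
      ((f * e ^ 2 * (∏ i, s i) * (s i * v i * t i ^ 2) : ℕ) : ℤ) := fun i => by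
    rw [← hA i, Int.sign_mul_natAbs]
  have hunit : ∀ {n : ℤ}, n ≠ 0 → IsUnit n.sign := fun {n} hn => by
    rw [Int.isUnit_iff]
    rcases lt_or_gt_of_ne hn with h | h
    · exact Or.inr (Int.sign_eq_neg_one_of_neg h)
    · exact Or.inl (Int.sign_eq_one_of_pos h)
  refine ⟨f, e, s, fun i => (a i).sign, y.sign, (v, t), hf, he, hs, fun i => hunit (ha0 i),
    hunit hy0, ⟨hv, ht, ?_, hcop⟩, hsign, ?_, ?_⟩
  · have hc : ((f * e ^ 2 * ∏ i, s i : ℕ) : ℤ) ≠ 0 := by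
      have : 0 < f * e ^ 2 * ∏ i, s i :=
        Nat.mul_pos (Nat.mul_pos hf (pow_pos he 2)) (Finset.prod_pos fun i _ => hs i)
      exact_mod_cast this.ne'
    refine mul_left_cancel₀ hc ?_
    rw [mul_zero, ← hsum, Finset.mul_sum]
    refine Finset.sum_congr rfl fun i _ => ?_
    conv_rhs => rw [hsign i]
    push_cast
    ring
  · rw [← hW]
    refine mul_right_cancel₀ (pow_ne_zero 2 hy0) ?_
    rw [← hprod]
    have : ∏ i, a i = (∏ i, (a i).sign) * ((∏ i, (a i).natAbs : ℕ) : ℤ) := by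
      push_cast
      rw [← Finset.prod_mul_distrib]
      refine Finset.prod_congr rfl fun i _ => ?_
      rw [← Int.natCast_natAbs, Int.sign_mul_natAbs]
    rw [this, hprodN]
    push_cast
    rw [sq_abs]; ring
  · rw [← hY, Int.sign_mul_natAbs]

/-- The solution of the cubic equation attached to torsor coordinates. -/
def torsorSolution (f e : ℕ) (s : Fin 3 → ℕ) (ε : Fin 3 → ℤ) (η : ℤ)
    (z : (Fin 3 → ℕ) × (Fin 3 → ℕ)) : Fin 4 → ℤ :=
  let A : Fin 3 → ℤ := fun i =>
    ε i * ((f * e ^ 2 * (∏ i, s i) * (s i * z.1 i * z.2 i ^ 2) : ℕ) : ℤ)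
  ![A 0, A 1, η * ((e ^ 3 * (∏ i, s i) ^ 2 * ∏ i, z.2 i : ℕ) : ℤ) - A 0 - A 1,
    (∏ i, ε i) * ((f ^ 3 * ∏ i, z.1 i : ℕ) : ℤ)]

open Classical in
/-- Torsor points with positive coordinates at most `M`, subject to the height conditions. -/
noncomputable def boundedTorsorPoints (B : ℝ) (M f e : ℕ) (s : Fin 3 → ℕ) (ε : Fin 3 → ℤ) :
    Finset ((Fin 3 → ℕ) × (Fin 3 → ℕ)) :=
  ((Fintype.piFinset fun _ => Finset.Icc 1 M) ×ˢ (Fintype.piFinset fun _ => Finset.Icc 1 M)).filter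
    fun z => IsTorsorPoint ε s z ∧
      (∀ i, ((s i * z.1 i * z.2 i ^ 2 : ℕ) : ℝ) ≤ 2 * B / (f * e ^ 2 * ∏ i, (s i : ℝ))) ∧
      ((∏ i, z.1 i : ℕ) : ℝ) ≤ B / f ^ 3

theorem exists_mem_boundedTorsorPoints {B : ℝ} {x : Fin 4 → ℤ}
    (hgcd : Finset.gcd Finset.univ (fun i => (x i).natAbs) = 1)
    (heq : x 0 * x 1 * (x 0 + x 1) + x 3 * (x 0 + x 1 + x 2) ^ 2 = 0)
    (hB : ∀ i, |(x i : ℝ)| ≤ B) (hne : x 3 * (x 0 + x 1 + x 2) ≠ 0) :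
    ∃ (f e : ℕ) (s : Fin 3 → ℕ) (ε : Fin 3 → ℤ) (η : ℤ) (z : (Fin 3 → ℕ) × (Fin 3 → ℕ)),
      f ∈ Finset.Icc 1 ⌊2 * B⌋₊ ∧ e ∈ Finset.Icc 1 ⌊2 * B⌋₊ ∧
      (∀ i, s i ∈ Finset.Icc 1 ⌊2 * B⌋₊) ∧ (∀ i, IsUnit (ε i)) ∧ IsUnit η ∧
      z ∈ boundedTorsorPoints B ⌊2 * B⌋₊ f e s ε ∧ torsorSolution f e s ε η z = x := by
  classical
  obtain ⟨f, e, s, ε, η, z, hf, he, hs, hε, hη, hz, hA, hw, hy⟩ :=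
    exists_torsorPoint_of_solution hgcd heq hne
  have hunit : ∀ {n : ℤ}, IsUnit n → |(n : ℝ)| = 1 := fun {n} hn => by
    rcases Int.isUnit_iff.1 hn with rfl | rfl <;> simp
  have hA0 := hA 0
  have hA1 := hA 1
  simp only [Matrix.cons_val] at hA0 hA1
  have hAB : ∀ i, ((f * e ^ 2 * (∏ i, s i) * (s i * z.1 i * z.2 i ^ 2) : ℕ) : ℝ) ≤ 2 * B := by
    intro i
    have h1 : ((f * e ^ 2 * (∏ i, s i) * (s i * z.1 i * z.2 i ^ 2) : ℕ) : ℝ)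
        = |(((![x 0, x 1, -(x 0 + x 1)] : Fin 3 → ℤ) i : ℤ) : ℝ)| := by
      rw [hA i, Int.cast_mul, abs_mul, hunit (hε i), one_mul, Int.cast_natCast, Nat.abs_cast]
    rw [h1]
    have b0 := hB 0
    have b1 := hB 1
    have b : 0 ≤ B := (abs_nonneg _).trans b0
    fin_cases i
    · simp only [Fin.zero_eta, Matrix.cons_val]; linarith
    · simp only [Fin.mk_one, Matrix.cons_val]; linarith
    · simp only [Fin.reduceFinMk, Matrix.cons_val]
      push_cast
      rw [abs_neg]
      exact (abs_add_le _ _).trans (by linarith)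
  have hAM : ∀ i, f * e ^ 2 * (∏ i, s i) * (s i * z.1 i * z.2 i ^ 2) ≤ ⌊2 * B⌋₊ := fun i =>
    Nat.le_floor (hAB i)
  have hle : ∀ i n, n ∣ f * e ^ 2 * (∏ i, s i) * (s i * z.1 i * z.2 i ^ 2) → n ≤ ⌊2 * B⌋₊ := by
    intro i n hn
    have hS : 0 < ∏ i, s i := Finset.prod_pos fun i _ => hs i
    have h1 := hs i
    have h2 := hz.1 i
    have h3 := hz.2.1 i
    exact (Nat.le_of_dvd (by positivity) hn).trans (hAM i)
  refine ⟨f, e, s, ε, η, z, ?_, ?_, ?_, hε, hη, ?_, ?_⟩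
  · exact Finset.mem_Icc.2 ⟨hf, hle 0 f ⟨e ^ 2 * (∏ i, s i) * (s 0 * z.1 0 * z.2 0 ^ 2), by ring⟩⟩
  · exact Finset.mem_Icc.2
      ⟨he, hle 0 e ⟨f * e * (∏ i, s i) * (s 0 * z.1 0 * z.2 0 ^ 2), by ring⟩⟩
  · exact fun i => Finset.mem_Icc.2
      ⟨hs i, hle i _ ⟨f * e ^ 2 * (∏ i, s i) * (z.1 i * z.2 i ^ 2), by ring⟩⟩
  · rw [boundedTorsorPoints, Finset.mem_filter, Finset.mem_product, Fintype.mem_piFinset,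
      Fintype.mem_piFinset]
    refine ⟨⟨fun i => Finset.mem_Icc.2 ⟨hz.1 i, hle i _
      ⟨f * e ^ 2 * (∏ i, s i) * (s i * z.2 i ^ 2), by ring⟩⟩,
      fun i => Finset.mem_Icc.2 ⟨hz.2.1 i, hle i _
      ⟨f * e ^ 2 * (∏ i, s i) * (s i * z.1 i * z.2 i), by ring⟩⟩⟩, hz, fun i => ?_, ?_⟩
    · have hS : (0 : ℝ) < f * e ^ 2 * ∏ i, (s i : ℝ) := by
        have : 0 < f * e ^ 2 * ∏ i, s i :=
          Nat.mul_pos (Nat.mul_pos hf (pow_pos he 2)) (Finset.prod_pos fun i _ => hs i)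
        exact_mod_cast this
      rw [le_div_iff₀ hS, mul_comm]
      have := hAB i
      push_cast at this ⊢
      exact this
    · have hf3 : (0 : ℝ) < f ^ 3 := by positivity
      rw [le_div_iff₀ hf3, mul_comm]
      have h3 := hB 3
      have hεp : IsUnit (∏ i, ε i) := by
        rw [Fin.prod_univ_three]; exact ((hε 0).mul (hε 1)).mul (hε 2)
      rw [hw, Int.cast_mul, abs_mul, hunit hεp, one_mul, Int.cast_natCast, Nat.abs_cast] at h3
      push_cast at h3 ⊢
      exact h3
  · funext i
    fin_cases i
    · exact hA0.symm
    · exact hA1.symm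
    · simp only [torsorSolution, Fin.reduceFinMk, Matrix.cons_val]
      rw [← hy, ← hA0, ← hA1]; ring
    · exact hw.symm

theorem card_solutions_le_sum (B : ℝ) :
    Nat.card {x : Fin 4 → ℤ //
          Finset.gcd Finset.univ (fun i => (x i).natAbs) = 1 ∧
          x 0 * x 1 * (x 0 + x 1) + x 3 * (x 0 + x 1 + x 2) ^ 2 = 0 ∧
          (∀ i, |(x i : ℝ)| ≤ B) ∧
          x 3 * (x 0 + x 1 + x 2) ≠ 0} ≤
      ∑ f ∈ Finset.Icc 1 ⌊2 * B⌋₊, ∑ e ∈ Finset.Icc 1 ⌊2 * B⌋₊,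
        ∑ s ∈ Fintype.piFinset fun _ : Fin 3 => Finset.Icc 1 ⌊2 * B⌋₊,
        ∑ ε ∈ Fintype.piFinset fun _ : Fin 3 => ({1, -1} : Finset ℤ), ∑ _η ∈ ({1, -1} : Finset ℤ),
          (boundedTorsorPoints B ⌊2 * B⌋₊ f e s ε).card := by
  classical
  set I := Finset.Icc 1 ⌊2 * B⌋₊ ×ˢ Finset.Icc 1 ⌊2 * B⌋₊ ×ˢ
    (Fintype.piFinset fun _ : Fin 3 => Finset.Icc 1 ⌊2 * B⌋₊) ×ˢ
    (Fintype.piFinset fun _ : Fin 3 => ({1, -1} : Finset ℤ)) ×ˢ ({1, -1} : Finset ℤ) with hI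
  set T := I.biUnion fun p => (boundedTorsorPoints B ⌊2 * B⌋₊ p.1 p.2.1 p.2.2.1 p.2.2.2.1).image
    (torsorSolution p.1 p.2.1 p.2.2.1 p.2.2.2.1 p.2.2.2.2) with hT
  have hsub : {x : Fin 4 → ℤ |
          Finset.gcd Finset.univ (fun i => (x i).natAbs) = 1 ∧
          x 0 * x 1 * (x 0 + x 1) + x 3 * (x 0 + x 1 + x 2) ^ 2 = 0 ∧
          (∀ i, |(x i : ℝ)| ≤ B) ∧
          x 3 * (x 0 + x 1 + x 2) ≠ 0} ⊆ T := by
    rintro x ⟨h1, h2, h3, h4⟩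
    obtain ⟨f, e, s, ε, η, z, hf, he, hs, hε, hη, hz, rfl⟩ :=
      exists_mem_boundedTorsorPoints h1 h2 h3 h4
    refine Finset.mem_coe.2 (Finset.mem_biUnion.2 ⟨(f, e, s, ε, η), ?_,
      Finset.mem_image_of_mem _ hz⟩)
    simp only [hI, Finset.mem_product, Fintype.mem_piFinset]
    refine ⟨hf, he, hs, fun i => ?_, ?_⟩
    · simpa using Int.isUnit_iff.1 (hε i)
    · simpa using Int.isUnit_iff.1 hη
  calc _ ≤ T.card := by
        rw [← Set.ncard_coe_finset]
        exact Set.ncard_le_ncard hsub (Finset.finite_toSet T)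
    _ ≤ ∑ p ∈ I, (boundedTorsorPoints B ⌊2 * B⌋₊ p.1 p.2.1 p.2.2.1 p.2.2.2.1).card :=
        Finset.card_biUnion_le.trans (Finset.sum_le_sum fun p _ => Finset.card_image_le)
    _ = _ := by simp only [hI, Finset.sum_product]

theorem sum_inv_Icc_le (M : ℕ) : ∑ n ∈ Finset.Icc 1 M, ((n : ℝ))⁻¹ ≤ 1 + Real.log M := by
  have := harmonic_le_one_add_log M
  rw [harmonic_eq_sum_Icc] at this
  push_cast at this
  exact this

theorem exists_sum_inv_sq_Icc_le :
    ∃ Q : ℝ, 0 ≤ Q ∧ ∀ M : ℕ, ∑ n ∈ Finset.Icc 1 M, ((n : ℝ) ^ 2)⁻¹ ≤ Q := by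
  have h : Summable fun n : ℕ => ((n : ℝ) ^ 2)⁻¹ := Real.summable_nat_pow_inv.2 one_lt_two
  exact ⟨_, tsum_nonneg fun n => by positivity, fun M =>
    h.sum_le_tsum _ fun n _ => by positivity⟩

theorem sum_torsor_weights_eq (M : ℕ) (D : ℝ) :
    ∑ f ∈ Finset.Icc 1 M, ∑ e ∈ Finset.Icc 1 M,
        ∑ s ∈ Fintype.piFinset fun _ : Fin 3 => Finset.Icc 1 M,
        ∑ _ε ∈ Fintype.piFinset fun _ : Fin 3 => ({1, -1} : Finset ℤ), ∑ _η ∈ ({1, -1} : Finset ℤ),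
          D * (((f : ℝ)⁻¹ * ((e : ℝ) ^ 2)⁻¹ + ((f : ℝ) ^ 2)⁻¹ * (e : ℝ)⁻¹) * ∏ i, (s i : ℝ)⁻¹) =
      32 * D * (∑ n ∈ Finset.Icc 1 M, ((n : ℝ) ^ 2)⁻¹) *
        (∑ n ∈ Finset.Icc 1 M, (n : ℝ)⁻¹) ^ 4 := by
  set H := ∑ n ∈ Finset.Icc 1 M, (n : ℝ)⁻¹ with hH
  set H₂ := ∑ n ∈ Finset.Icc 1 M, ((n : ℝ) ^ 2)⁻¹ with hH₂
  have h3 : ∑ s ∈ Fintype.piFinset fun _ : Fin 3 => Finset.Icc 1 M, ∏ i, (s i : ℝ)⁻¹ = H ^ 3 := by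
    rw [← Finset.prod_univ_sum (fun _ : Fin 3 => Finset.Icc 1 M) fun _ n => (n : ℝ)⁻¹]
    simp [hH]
  have hε : (Fintype.piFinset fun _ : Fin 3 => ({1, -1} : Finset ℤ)).card = 8 := by
    rw [Fintype.card_piFinset]; simp
  have hη : ({1, -1} : Finset ℤ).card = 2 := by simp
  simp only [Finset.sum_const, hε, hη, nsmul_eq_mul, ← Finset.mul_sum, h3]
  simp only [← Finset.sum_mul, ← Finset.mul_sum, Finset.sum_add_distrib]
  rw [← hH, ← hH₂]
  push_cast
  ring

theorem card_boundedTorsorPoints_le {K : ℝ} (hK0 : 0 ≤ K)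
    (hK : ∀ (N : ℕ) (ε : Fin 3 → ℤ) (s : Fin 3 → ℕ) (X Z : ℝ)
      (S : Finset ((Fin 3 → ℕ) × (Fin 3 → ℕ))), (∀ i, IsUnit (ε i)) → (∀ i, 0 < s i) →
      0 ≤ X → X ≤ 2 ^ N →
      (∀ z ∈ S, IsTorsorPoint ε s z ∧ (∀ i, ((s i * z.1 i * z.2 i ^ 2 : ℕ) : ℝ) ≤ X) ∧
        ((∏ i, z.1 i : ℕ) : ℝ) ≤ Z) →
      (S.card : ℝ) ≤ K * (X + √(X * Z / ∏ i, (s i : ℝ))) * ((N : ℝ) + 1) ^ 2)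
    {B : ℝ} (hB : 0 ≤ B) {N : ℕ} (hN : 2 * B ≤ 2 ^ N) {M f e : ℕ} {s : Fin 3 → ℕ}
    {ε : Fin 3 → ℤ} (hf : 0 < f) (he : 0 < e) (hs : ∀ i, 0 < s i) (hε : ∀ i, IsUnit (ε i)) :
    ((boundedTorsorPoints B M f e s ε).card : ℝ) ≤ 2 * K * B * ((N : ℝ) + 1) ^ 2 *
      (((f : ℝ)⁻¹ * ((e : ℝ) ^ 2)⁻¹ + ((f : ℝ) ^ 2)⁻¹ * (e : ℝ)⁻¹) * ∏ i, (s i : ℝ)⁻¹) := by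
  classical
  have hS : (1 : ℝ) ≤ ∏ i, (s i : ℝ) := by
    have : 0 < ∏ i, s i := Finset.prod_pos fun i _ => hs i
    exact_mod_cast this
  have hf1 : (1 : ℝ) ≤ f := by exact_mod_cast hf
  have he1 : (1 : ℝ) ≤ e := by exact_mod_cast he
  have main := hK N ε s (2 * B / (f * e ^ 2 * ∏ i, (s i : ℝ))) (B / f ^ 3)
    (boundedTorsorPoints B M f e s ε) hε hs (by positivity) (by
      refine (div_le_self (by positivity) ?_).trans hN
      exact one_le_mul_of_one_le_of_one_le
        (one_le_mul_of_one_le_of_one_le hf1 (one_le_pow₀ he1)) hS)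
    (fun z hz => (Finset.mem_filter.1 hz).2)
  refine main.trans ?_
  rw [Finset.prod_inv_distrib]
  set P := ∏ i, (s i : ℝ) with hP
  have hP0 : 0 < P := by linarith
  have hsq : √(2 * B / (f * e ^ 2 * P) * (B / f ^ 3) / P) ≤ 2 * B / (f ^ 2 * e * P) := by
    rw [Real.sqrt_le_left (by positivity)]
    have : 2 * B / (f * e ^ 2 * P) * (B / f ^ 3) / P = (2 * B ^ 2) / (f ^ 2 * e * P) ^ 2 := by
      field_simp
    rw [this, div_pow]
    gcongr
    nlinarith [sq_nonneg B]
  calc K * (2 * B / (f * e ^ 2 * P) + √(2 * B / (f * e ^ 2 * P) * (B / f ^ 3) / P))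
        * ((N : ℝ) + 1) ^ 2
      ≤ K * (2 * B / (f * e ^ 2 * P) + 2 * B / (f ^ 2 * e * P)) * ((N : ℝ) + 1) ^ 2 := by gcongr
    _ = _ := by field_simp

theorem stmt_15 :
    ∃ C : ℝ, ∀ B : ℝ, 2 ≤ B →
      (Nat.card {x : Fin 4 → ℤ //
          Finset.gcd Finset.univ (fun i => (x i).natAbs) = 1 ∧
          x 0 * x 1 * (x 0 + x 1) + x 3 * (x 0 + x 1 + x 2) ^ 2 = 0 ∧
          (∀ i, |(x i : ℝ)| ≤ B) ∧
          x 3 * (x 0 + x 1 + x 2) ≠ 0} : ℝ)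
        ≤ C * B * Real.log B ^ 6 := by
  obtain ⟨K, hK0, hK⟩ := exists_card_torsorPoints_le
  obtain ⟨Q, hQ0, hQ⟩ := exists_sum_inv_sq_Icc_le
  refine ⟨32 * (2 * K * 7 ^ 2) * Q * 4 ^ 4, fun B hB => ?_⟩
  set N := ⌈Real.logb 2 (2 * B)⌉₊ with hN
  set M := ⌊2 * B⌋₊ with hM
  have hB0 : 0 < B := by linarith
  have hl2 : 0.69 < Real.log 2 := by linarith [Real.log_two_gt_d9]
  have hl2' : Real.log 2 < 0.7 := by linarith [Real.log_two_lt_d9]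
  have hlB : Real.log 2 ≤ Real.log B := Real.log_le_log two_pos hB
  have hl2B : Real.log (2 * B) = Real.log 2 + Real.log B := Real.log_mul two_ne_zero hB0.ne'
  have hBN : 2 * B ≤ 2 ^ N := by
    rw [← Real.rpow_natCast, ← Real.logb_le_iff_le_rpow one_lt_two (by positivity)]
    exact Nat.le_ceil _
  have hNB : (N : ℝ) + 1 ≤ 7 * Real.log B := by
    have h1 : (N : ℝ) < Real.logb 2 (2 * B) + 1 :=
      Nat.ceil_lt_add_one (Real.logb_nonneg one_lt_two (by linarith))
    have h2 : Real.logb 2 (2 * B) ≤ 2 * Real.log B + 1 := by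
      rw [Real.logb, div_le_iff₀ (by linarith), hl2B]
      nlinarith
    linarith
  have hH : ∑ n ∈ Finset.Icc 1 M, (n : ℝ)⁻¹ ≤ 4 * Real.log B := by
    have h1 : Real.log M ≤ Real.log (2 * B) := by
      refine Real.log_le_log ?_ (Nat.floor_le (by linarith))
      exact_mod_cast Nat.floor_pos.2 (by linarith)
    linarith [sum_inv_Icc_le M]
  have hcard := Nat.cast_le (α := ℝ).2 (card_solutions_le_sum B)
  push_cast at hcard
  calc _ ≤ _ := hcard
    _ ≤ ∑ f ∈ Finset.Icc 1 M, ∑ e ∈ Finset.Icc 1 M,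
        ∑ s ∈ Fintype.piFinset fun _ : Fin 3 => Finset.Icc 1 M,
        ∑ _ε ∈ Fintype.piFinset fun _ : Fin 3 => ({1, -1} : Finset ℤ), ∑ _η ∈ ({1, -1} : Finset ℤ),
          (2 * K * B * ((N : ℝ) + 1) ^ 2) *
            (((f : ℝ)⁻¹ * ((e : ℝ) ^ 2)⁻¹ + ((f : ℝ) ^ 2)⁻¹ * (e : ℝ)⁻¹) * ∏ i, (s i : ℝ)⁻¹) := by
        refine Finset.sum_le_sum fun f hf => Finset.sum_le_sum fun e he =>
          Finset.sum_le_sum fun s hs => Finset.sum_le_sum fun ε hε => Finset.sum_le_sum fun η _ => ?_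
        refine card_boundedTorsorPoints_le hK0 hK hB0.le hBN (Finset.mem_Icc.1 hf).1
          (Finset.mem_Icc.1 he).1 (fun i => (Finset.mem_Icc.1 (Fintype.mem_piFinset.1 hs i)).1)
          fun i => Int.isUnit_iff.2 ?_
        simpa using Fintype.mem_piFinset.1 hε i
    _ = 32 * (2 * K * B * ((N : ℝ) + 1) ^ 2) * (∑ n ∈ Finset.Icc 1 M, ((n : ℝ) ^ 2)⁻¹) *
        (∑ n ∈ Finset.Icc 1 M, (n : ℝ)⁻¹) ^ 4 := sum_torsor_weights_eq M _
    _ ≤ 32 * (2 * K * B * (7 * Real.log B) ^ 2) * Q * (4 * Real.log B) ^ 4 := by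
        gcongr
        exact hQ M
    _ = _ := by ring
end

section
/- Let N_U(B) denote half the number of primitive vectors x ∈ ℤ^7 with max_{1≤i≤7}|x_i| ≤ B satisfying x_1^2 − x_2x_4 = x_1x_5 − x_3x_4 = x_1x_3 − x_2x_5 = x_1x_6 − x_3x_5 = x_2x_6 − x_3^2 = x_4x_6 − x_5^2 = x_1^2 + x_1x_4 + x_5x_7 = x_1x_2 + x_1^2 + x_3x_7 = x_1x_3 + x_1x_5 + x_6x_7 = 0 and not lying on any of the three lines {x_1 = x_2 = x_3 = x_5 = x_6 = 0}, {x_1 = x_3 = x_4 = x_5 = x_6 = 0}, {x_3 = x_5 = x_6 = x_1+x_4 = x_1+x_2 = 0}. For (s_0, s_1, s_2, s_3, y_1, y_2, y_3) ∈ ℝ^7 set Ψ(s_0,s,y) := max{ |s_0^3 s_1^2 s_2^2 s_3^2|, |y_1y_2y_3|, |s_0 s_1^2 y_1^2|, |s_0 s_2^2 y_2^2| }. Then N_U(B) = 2·#{ (s_0,s_1,s_2,s_3,y_1,y_2,y_3) ∈ ℤ^7 : Ψ(s_0,s,y) ≤ B; s_1y_1 − s_2y_2 + s_3y_3 = 0;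 s_0, s_1, s_2, s_3, y_1 > 0; gcd(y_i, s_0 s_j s_k) = 1 for every permutation {i,j,k} of {1,2,3}; and gcd(s_i, s_j) = 1 for all i ≠ j } + O(B). -/
/-- The rational points of height at most `N` on the sextic del Pezzo surface of type `A₁`, away
from its lines, represented by primitive integral vectors. -/
def IsSurfacePoint (N : ℤ) (x : Fin 7 → ℤ) : Prop :=
  Finset.gcd Finset.univ (fun i => (x i).natAbs) = 1 ∧
  (∀ i, |x i| ≤ N) ∧
  x 0 ^ 2 - x 1 * x 3 = 0 ∧
  x 0 * x 4 - x 2 * x 3 = 0 ∧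
  x 0 * x 2 - x 1 * x 4 = 0 ∧
  x 0 * x 5 - x 2 * x 4 = 0 ∧
  x 1 * x 5 - x 2 ^ 2 = 0 ∧
  x 3 * x 5 - x 4 ^ 2 = 0 ∧
  x 0 ^ 2 + x 0 * x 3 + x 4 * x 6 = 0 ∧
  x 0 * x 1 + x 0 ^ 2 + x 2 * x 6 = 0 ∧
  x 0 * x 2 + x 0 * x 4 + x 5 * x 6 = 0 ∧
  ¬ (x 0 = 0 ∧ x 1 = 0 ∧ x 2 = 0 ∧ x 4 = 0 ∧ x 5 = 0) ∧
  ¬ (x 0 = 0 ∧ x 2 = 0 ∧ x 3 = 0 ∧ x 4 = 0 ∧ x 5 = 0) ∧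
  ¬ (x 2 = 0 ∧ x 4 = 0 ∧ x 5 = 0 ∧ x 0 + x 3 = 0 ∧ x 0 + x 1 = 0)

/-- The integral points of height at most `N` on the universal torsor, with no sign condition
on the `y`-coordinates. -/
structure IsTorsorPoint_s18 (N : ℤ) (p : (Fin 4 → ℤ) × (Fin 3 → ℤ)) : Prop where
  height_s : p.1 0 ^ 3 * p.1 1 ^ 2 * p.1 2 ^ 2 * p.1 3 ^ 2 ≤ N
  height_y : |p.2 0 * p.2 1 * p.2 2| ≤ N
  height_one : p.1 0 * p.1 1 ^ 2 * p.2 0 ^ 2 ≤ N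
  height_two : p.1 0 * p.1 2 ^ 2 * p.2 1 ^ 2 ≤ N
  torsor : p.1 1 * p.2 0 - p.1 2 * p.2 1 + p.1 3 * p.2 2 = 0
  pos_zero : 0 < p.1 0
  pos_one : 0 < p.1 1
  pos_two : 0 < p.1 2
  pos_three : 0 < p.1 3
  coprime_y_one : IsCoprime (p.2 0) (p.1 0 * p.1 2 * p.1 3)
  coprime_y_two : IsCoprime (p.2 1) (p.1 0 * p.1 1 * p.1 3)
  coprime_y_three : IsCoprime (p.2 2) (p.1 0 * p.1 1 * p.1 2)
  coprime_one_two : IsCoprime (p.1 1) (p.1 2)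
  coprime_one_three : IsCoprime (p.1 1) (p.1 3)
  coprime_two_three : IsCoprime (p.1 2) (p.1 3)

/-- The map from the universal torsor to the affine cone over the surface. -/
def torsorMap (p : (Fin 4 → ℤ) × (Fin 3 → ℤ)) : Fin 7 → ℤ :=
  ![-(p.1 0 * p.1 1 * p.1 2 * p.2 0 * p.2 1),
    p.1 0 * p.1 1 ^ 2 * p.2 0 ^ 2,
    p.1 0 ^ 2 * p.1 1 ^ 2 * p.1 2 * p.1 3 * p.2 0,
    p.1 0 * p.1 2 ^ 2 * p.2 1 ^ 2,
    -(p.1 0 ^ 2 * p.1 1 * p.1 2 ^ 2 * p.1 3 * p.2 1),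
    p.1 0 ^ 3 * p.1 1 ^ 2 * p.1 2 ^ 2 * p.1 3 ^ 2,
    -(p.2 0 * p.2 1 * p.2 2)]

theorem ncard_eq_two_mul_add_of_involutive {α : Type*} {S : Set α} (hS : S.Finite) {ι : α → α}
    (hι : Function.Involutive ι) (hmaps : ∀ x ∈ S, ι x ∈ S) (f : α → ℤ)
    (hf : ∀ x, f (ι x) = -f x) :
    S.ncard = 2 * {x ∈ S | 0 < f x}.ncard + {x ∈ S | f x = 0}.ncard := by
  have hneg : {x ∈ S | f x < 0} = ι '' {x ∈ S | 0 < f x} := by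
    ext x
    constructor
    · rintro ⟨hx, hlt⟩
      exact ⟨ι x, ⟨hmaps x hx, by rw [hf]; omega⟩, hι x⟩
    · rintro ⟨z, ⟨hz, hlt⟩, rfl⟩
      exact ⟨hmaps z hz, by rw [hf]; omega⟩
  have hcard : {x ∈ S | f x < 0}.ncard = {x ∈ S | 0 < f x}.ncard := by
    rw [hneg, Set.ncard_image_of_injective _ hι.injective]
  have hfin (P : α → Prop) : {x ∈ S | P x}.Finite := hS.subset fun x hx => hx.1
  have hunion : S = ({x ∈ S | 0 < f x} ∪ {x ∈ S | f x < 0}) ∪ {x ∈ S | f x = 0} := by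
    ext x
    simp only [Set.mem_union, Set.mem_ofPred_eq]
    rcases lt_trichotomy (f x) 0 with h | h | h <;> grind
  conv_lhs => rw [hunion]
  rw [Set.ncard_union_eq _ ((hfin _).union (hfin _)) (hfin _),
    Set.ncard_union_eq _ (hfin _) (hfin _), hcard]
  · ring
  · rw [Set.disjoint_left]
    rintro x ⟨-, h⟩ ⟨-, h'⟩
    omega
  · rw [Set.disjoint_left]
    rintro x (⟨-, h⟩ | ⟨-, h⟩) ⟨-, h'⟩ <;> omega

theorem eq_of_primitive_of_proportional {a b c a' b' c' : ℤ} (hc : 0 < c) (hc' : 0 < c')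
    (h : ∃ p q r, p * a + q * b + r * c = 1) (h' : ∃ p q r, p * a' + q * b' + r * c' = 1)
    (ha : a * c' = a' * c) (hb : b * c' = b' * c) : a = a' ∧ b = b' ∧ c = c' := by
  obtain ⟨p, q, r, h⟩ := h
  obtain ⟨p', q', r', h'⟩ := h'
  have hcc : c = c' := by
    refine Int.dvd_antisymm hc.le hc'.le ⟨p * a' + q * b' + r * c', ?_⟩
      ⟨p' * a + q' * b + r' * c, ?_⟩
    · linear_combination -c' * h + p * ha + q * hb
    · linear_combination -c * h' - p' * ha - q' * hb
  subst hcc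
  exact ⟨mul_right_cancel₀ hc.ne' ha, mul_right_cancel₀ hc.ne' hb, rfl⟩

theorem exists_veronese_parametrization {x₁ x₂ x₃ x₄ x₅ x₆ : ℤ} (hpos : 0 < x₆)
    (h₁ : x₁ * x₆ = x₃ * x₅) (h₂ : x₂ * x₆ = x₃ ^ 2) (h₄ : x₄ * x₆ = x₅ ^ 2) :
    ∃ u a b c : ℤ, 0 < u ∧ 0 < c ∧ (∃ p q r, p * a + q * b + r * c = 1) ∧
      x₁ = u * a * b ∧ x₂ = u * a ^ 2 ∧ x₃ = u * a * c ∧ x₄ = u * b ^ 2 ∧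
      x₅ = u * b * c ∧ x₆ = u * c ^ 2 := by
  have hg : 0 < Int.gcd (Int.gcd x₃ x₅) x₆ := Int.gcd_pos_of_ne_zero_right _ hpos.ne'
  obtain ⟨g, hgdef⟩ : ∃ g : ℤ, g = Int.gcd (Int.gcd x₃ x₅) x₆ := ⟨_, rfl⟩
  have hg0 : 0 < g := by omega
  have hgd : g ∣ Int.gcd x₃ x₅ := hgdef ▸ Int.gcd_dvd_left ..
  obtain ⟨a, ha⟩ : g ∣ x₃ := hgd.trans (Int.gcd_dvd_left ..)
  obtain ⟨b, hb⟩ : g ∣ x₅ := hgd.trans (Int.gcd_dvd_right ..)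
  obtain ⟨c, hc⟩ : g ∣ x₆ := hgdef ▸ Int.gcd_dvd_right ..
  obtain ⟨p, q, r, hbez⟩ : ∃ p q r, p * a + q * b + r * c = 1 := by
    have e₁ := Int.gcd_eq_gcd_ab (Int.gcd x₃ x₅) x₆
    have e₂ := Int.gcd_eq_gcd_ab x₃ x₅
    rw [← hgdef] at e₁
    generalize Int.gcdA (Int.gcd x₃ x₅) x₆ = t at e₁
    generalize Int.gcdB (Int.gcd x₃ x₅) x₆ = v at e₁
    generalize Int.gcdA x₃ x₅ = t' at e₂
    generalize Int.gcdB x₃ x₅ = v' at e₂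
    refine ⟨t' * t, v' * t, v, mul_left_cancel₀ hg0.ne' ?_⟩
    linear_combination -e₁ - t * e₂ - t' * t * ha - v' * t * hb - v * hc
  have hc0 : 0 < c := by
    rw [hc] at hpos
    exact pos_of_mul_pos_right hpos hg0.le
  have k₁ : x₁ * c = g * a * b := mul_left_cancel₀ hg0.ne' (by subst ha hb hc; linear_combination h₁)
  have k₂ : x₂ * c = g * a ^ 2 := mul_left_cancel₀ hg0.ne' (by subst ha hb hc; linear_combination h₂)
  have k₄ : x₄ * c = g * b ^ 2 := mul_left_cancel₀ hg0.ne' (by subst ha hb hc; linear_combination h₄)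
  obtain ⟨u, hu⟩ : c ∣ g := by
    refine ⟨p ^ 2 * x₂ + q ^ 2 * x₄ + 2 * p * q * x₁ + g * r * (2 * p * a + 2 * q * b + r * c), ?_⟩
    linear_combination -g * (1 + p * a + q * b + r * c) * hbez - p ^ 2 * k₂ - q ^ 2 * k₄ -
      2 * p * q * k₁
  have hu0 : 0 < u := by
    rw [hu] at hg0
    exact pos_of_mul_pos_right hg0 hc0.le
  refine ⟨u, a, b, c, hu0, hc0, ⟨p, q, r, hbez⟩, mul_right_cancel₀ hc0.ne' ?_,
    mul_right_cancel₀ hc0.ne' ?_, ?_, mul_right_cancel₀ hc0.ne' ?_, ?_, ?_⟩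
  · rw [k₁, hu]; ring
  · rw [k₂, hu]; ring
  · rw [ha, hu]; ring
  · rw [k₄, hu]; ring
  · rw [hb, hu]; ring
  · rw [hc, hu]; ring

theorem exists_torsor_coordinates_s18 {u a b c w : ℤ} (hu : 0 < u) (hc : 0 < c)
    (hbez : ∃ p q r, p * a + q * b + r * c = 1) (hw : c * w = -(u * a * b * (a + b)))
    (huw : IsCoprime u w) :
    ∃ s₁ s₂ s₃ y₁ y₂ y₃ : ℤ, 0 < s₁ ∧ 0 < s₂ ∧ 0 < s₃ ∧ c = u * s₁ * s₂ * s₃ ∧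
      a = s₁ * y₁ ∧ b = -(s₂ * y₂) ∧ w = -(y₁ * y₂ * y₃) ∧
      s₁ * y₁ - s₂ * y₂ + s₃ * y₃ = 0 ∧
      IsCoprime y₁ (u * s₂ * s₃) ∧ IsCoprime y₂ (u * s₁ * s₃) ∧ IsCoprime y₃ (u * s₁ * s₂) ∧
      IsCoprime s₁ s₂ ∧ IsCoprime s₁ s₃ ∧ IsCoprime s₂ s₃ := by
  obtain ⟨p, q, r, hbez⟩ := hbez
  obtain ⟨d, rfl⟩ : u ∣ c := by
    refine huw.dvd_of_dvd_mul_right ⟨-(a * b * (a + b)), ?_⟩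
    rw [hw]; ring
  have hd : 0 < d := pos_of_mul_pos_right hc hu.le
  have hdw : d * w = -(a * b * (a + b)) := mul_left_cancel₀ hu.ne' (by linear_combination hw)
  have coprime_of_dvd {e f : ℤ} (h : ∀ l : ℤ, l ∣ e → l ∣ f → l ∣ a ∧ l ∣ b ∧ l ∣ d) :
      IsCoprime e f := by
    rw [Int.isCoprime_iff_gcd_eq_one]
    obtain ⟨ha, hb, hd⟩ := h (Int.gcd e f) (Int.gcd_dvd_left ..) (Int.gcd_dvd_right ..)
    have h1 : (Int.gcd e f : ℤ) ∣ 1 := by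
      rw [← hbez]
      exact dvd_add (dvd_add (ha.mul_left _) (hb.mul_left _)) ((hd.mul_left _).mul_left _)
    exact Nat.dvd_one.1 (Int.natCast_dvd_natCast.1 (by simpa using h1))
  have hpos (e : ℤ) : (0 : ℤ) < Int.gcd d e := by
    exact_mod_cast Int.gcd_pos_of_ne_zero_left _ hd.ne'
  obtain ⟨s₁, hs₁⟩ : ∃ s : ℤ, s = Int.gcd d a := ⟨_, rfl⟩
  obtain ⟨s₂, hs₂⟩ : ∃ s : ℤ, s = Int.gcd d b := ⟨_, rfl⟩
  obtain ⟨s₃, hs₃⟩ : ∃ s : ℤ, s = Int.gcd d (a + b) := ⟨_, rfl⟩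
  have p₁ : 0 < s₁ := hs₁ ▸ hpos a
  have p₂ : 0 < s₂ := hs₂ ▸ hpos b
  have p₃ : 0 < s₃ := hs₃ ▸ hpos (a + b)
  have d₁ : s₁ ∣ d := hs₁ ▸ Int.gcd_dvd_left ..
  have d₂ : s₂ ∣ d := hs₂ ▸ Int.gcd_dvd_left ..
  have d₃ : s₃ ∣ d := hs₃ ▸ Int.gcd_dvd_left ..
  have a₁ : s₁ ∣ a := hs₁ ▸ Int.gcd_dvd_right ..
  have a₂ : s₂ ∣ b := hs₂ ▸ Int.gcd_dvd_right ..
  have a₃ : s₃ ∣ a + b := hs₃ ▸ Int.gcd_dvd_right ..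
  have c₁₂ : IsCoprime s₁ s₂ :=
    coprime_of_dvd fun l h h' => ⟨h.trans a₁, h'.trans a₂, h.trans d₁⟩
  have c₁₃ : IsCoprime s₁ s₃ := coprime_of_dvd fun l h h' =>
    ⟨h.trans a₁, (dvd_add_right (h.trans a₁)).1 (h'.trans a₃), h.trans d₁⟩
  have c₂₃ : IsCoprime s₂ s₃ := coprime_of_dvd fun l h h' =>
    ⟨(dvd_add_left (h.trans a₂)).1 (h'.trans a₃), h.trans a₂, h.trans d₂⟩
  have hprod : d = s₁ * s₂ * s₃ := by
    refine Int.dvd_antisymm hd.le (by positivity) ?_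
      ((c₁₃.mul_left c₂₃).mul_dvd (c₁₂.mul_dvd d₁ d₂) d₃)
    have hdvd : d ∣ a * b * (a + b) := ⟨-w, by linear_combination hdw⟩
    have hnat : d.natAbs ∣ Int.gcd d a * Int.gcd d b * Int.gcd d (a + b) := by
      have h := Int.natAbs_dvd_natAbs.2 hdvd
      rw [Int.natAbs_mul, Int.natAbs_mul] at h
      rw [← Nat.gcd_eq_left h]
      exact (Nat.gcd_mul_right_dvd_mul_gcd ..).trans
        (Nat.mul_dvd_mul_right (Nat.gcd_mul_right_dvd_mul_gcd ..) _)
    rw [hs₁, hs₂, hs₃, ← Int.natAbs_dvd]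
    exact_mod_cast hnat
  obtain ⟨y₁, hy₁⟩ := a₁
  obtain ⟨z₂, hz₂⟩ := a₂
  obtain ⟨z₃, hz₃⟩ := a₃
  have hwy : w = -(y₁ * z₂ * z₃) := by
    refine mul_left_cancel₀ hd.ne' ?_
    rw [hdw, hz₃, hprod]
    nth_rewrite 1 [hy₁, hz₂]
    ring
  have g₁ : IsCoprime y₁ u := (huw.of_isCoprime_of_dvd_right ⟨-(z₂ * z₃), by rw [hwy]; ring⟩).symm
  have g₂ : IsCoprime (-z₂) u :=
    (huw.of_isCoprime_of_dvd_right ⟨y₁ * z₃, by rw [hwy]; ring⟩).symm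
  have g₃ : IsCoprime (-z₃) u :=
    (huw.of_isCoprime_of_dvd_right ⟨y₁ * z₂, by rw [hwy]; ring⟩).symm
  have b₁ {l : ℤ} (h : l ∣ y₁) : l ∣ a := hy₁ ▸ h.mul_left _
  have b₂ {l : ℤ} (h : l ∣ -z₂) : l ∣ b := hz₂ ▸ ((dvd_neg.1 h).mul_left _)
  have b₃ {l : ℤ} (h : l ∣ -z₃) : l ∣ a + b := hz₃ ▸ ((dvd_neg.1 h).mul_left _)
  have a₁ : s₁ ∣ a := ⟨_, hy₁⟩
  have a₂ : s₂ ∣ b := ⟨_, hz₂⟩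
  have a₃ : s₃ ∣ a + b := ⟨_, hz₃⟩
  refine ⟨s₁, s₂, s₃, y₁, -z₂, -z₃, p₁, p₂, p₃, by rw [hprod]; ring, hy₁, by rw [hz₂]; ring,
    by rw [hwy]; ring, by linear_combination -hy₁ - hz₂ + hz₃,
    (g₁.mul_right ?_).mul_right ?_, (g₂.mul_right ?_).mul_right ?_,
    (g₃.mul_right ?_).mul_right ?_, c₁₂, c₁₃, c₂₃⟩
  · exact coprime_of_dvd fun l h h' => ⟨b₁ h, h'.trans a₂, h'.trans d₂⟩
  · exact coprime_of_dvd fun l h h' =>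
      ⟨b₁ h, (dvd_add_right (b₁ h)).1 (h'.trans a₃), h'.trans d₃⟩
  · exact coprime_of_dvd fun l h h' => ⟨h'.trans a₁, b₂ h, h'.trans d₁⟩
  · exact coprime_of_dvd fun l h h' =>
      ⟨(dvd_add_left (b₂ h)).1 (h'.trans a₃), b₂ h, h'.trans d₃⟩
  · exact coprime_of_dvd fun l h h' =>
      ⟨h'.trans a₁, (dvd_add_right (h'.trans a₁)).1 (b₃ h), h'.trans d₁⟩
  · exact coprime_of_dvd fun l h h' =>
      ⟨(dvd_add_left (h'.trans a₂)).1 (b₃ h), h'.trans a₂, h'.trans d₂⟩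

theorem primitive_iff_forall_prime {ι : Type*} [Fintype ι] (x : ι → ℤ) :
    Finset.gcd Finset.univ (fun i => (x i).natAbs) = 1 ↔
      ∀ l : ℤ, Prime l → ¬ ∀ i, l ∣ x i := by
  constructor
  · intro h l hl hdvd
    have h1 : l.natAbs ∣ Finset.gcd Finset.univ (fun i => (x i).natAbs) :=
      Finset.dvd_gcd fun i _ => Int.natAbs_dvd_natAbs.2 (hdvd i)
    rw [h] at h1
    exact hl.not_isUnit (Int.isUnit_iff_natAbs_eq.2 (Nat.dvd_one.1 h1))
  · intro h
    by_contra hne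
    obtain ⟨l, hl, hdvd⟩ := Nat.exists_prime_and_dvd hne
    refine h l (Nat.prime_iff_prime_int.1 hl) fun i => ?_
    exact Int.natCast_dvd.2 (hdvd.trans (Finset.gcd_dvd (Finset.mem_univ i)))

theorem IsSurfacePoint.neg {N : ℤ} {x : Fin 7 → ℤ} (h : IsSurfacePoint N x) :
    IsSurfacePoint N (-x) := by
  unfold IsSurfacePoint at h ⊢
  simp only [Pi.neg_apply, Int.natAbs_neg, abs_neg, neg_eq_zero, neg_sq, neg_mul_neg, ← neg_add]
  exact h

theorem IsSurfacePoint.apply_five_ne_zero {N : ℤ} {x : Fin 7 → ℤ} (h : IsSurfacePoint N x) :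
    x 5 ≠ 0 := by
  obtain ⟨-, -, e₁, -, -, -, e₅, e₆, e₇, e₈, -, l₁, l₂, l₃⟩ := h
  intro h5
  have h2 : x 2 = 0 := by
    rw [h5] at e₅
    exact pow_eq_zero_iff two_ne_zero |>.1 (by linarith)
  have h4 : x 4 = 0 := by
    rw [h5] at e₆
    exact pow_eq_zero_iff two_ne_zero |>.1 (by linarith)
  rw [h4] at e₇
  rw [h2] at e₈
  by_cases h0 : x 0 = 0
  · have h13 : x 1 * x 3 = 0 := by rw [h0] at e₁; linarith
    rcases mul_eq_zero.1 h13 with h | h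
    · exact l₁ ⟨h0, h, h2, h4, h5⟩
    · exact l₂ ⟨h0, h2, h, h4, h5⟩
  · exact l₃ ⟨h2, h4, h5, mul_left_cancel₀ h0 (by linarith), mul_left_cancel₀ h0 (by linarith)⟩

theorem abs_le_of_sq_eq_mul {m e f N : ℤ} (h : m ^ 2 = e * f) (he₀ : 0 ≤ e)
    (he : e ≤ N) (hf : f ≤ N) : |m| ≤ N :=
  abs_le_of_sq_le_sq (by nlinarith [he₀.trans he]) (he₀.trans he)

theorem IsTorsorPoint_s18.isSurfacePoint {N : ℤ} {p : (Fin 4 → ℤ) × (Fin 3 → ℤ)}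
    (h : IsTorsorPoint_s18 N p) : IsSurfacePoint N (torsorMap p) := by
  obtain ⟨⟨s, y⟩, rfl⟩ : ∃ q, q = p := ⟨p, rfl⟩
  obtain ⟨hs, hy, h₁, h₂, ht, p₀, p₁, p₂, p₃, c₁, c₂, c₃, c₁₂, c₁₃, c₂₃⟩ := h
  dsimp only at *
  have n₁ : 0 ≤ s 0 * s 1 ^ 2 * y 0 ^ 2 := by positivity
  have n₂ : 0 ≤ s 0 * s 2 ^ 2 * y 1 ^ 2 := by positivity
  have ns : 0 < s 0 ^ 3 * s 1 ^ 2 * s 2 ^ 2 * s 3 ^ 2 := by positivity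
  unfold IsSurfacePoint
  refine ⟨?_, ?_, ?_, ?_, ?_, ?_, ?_, ?_, ?_, ?_, ?_, ?_, ?_, ?_⟩
  · rw [primitive_iff_forall_prime]
    intro l hl hdvd
    have q₁ : l ∣ s 0 * s 1 ^ 2 * y 0 ^ 2 := hdvd 1
    have q₂ : l ∣ s 0 * s 2 ^ 2 * y 1 ^ 2 := hdvd 3
    have qs : l ∣ s 0 ^ 3 * s 1 ^ 2 * s 2 ^ 2 * s 3 ^ 2 := hdvd 5
    have qy : l ∣ y 0 * y 1 * y 2 := dvd_neg.1 (hdvd 6)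
    have key {e f : ℤ} (hef : IsCoprime e f) (he : l ∣ e) (hf : l ∣ f) : False :=
      hl.not_isUnit (hef.isUnit_of_dvd' he hf)
    simp only [hl.dvd_mul, hl.dvd_pow_iff_dvd (two_ne_zero), hl.dvd_pow_iff_dvd (three_ne_zero)]
      at q₁ q₂ qs qy
    rcases qy with (hy | hy) | hy
    · have h1 : l ∣ s 1 := by
        rcases qs with ((h | h) | h) | h
        · exact (key c₁ hy ((h.mul_right _).mul_right _)).elim
        · exact h
        · exact (key c₁ hy ((h.mul_left _).mul_right _)).elim
        · exact (key c₁ hy (h.mul_left _)).elim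
      rcases q₂ with (h | h) | h
      · exact key c₁ hy ((h.mul_right _).mul_right _)
      · exact key c₁ hy ((h.mul_left _).mul_right _)
      · exact key c₂ h ((h1.mul_left _).mul_right _)
    · have h2 : l ∣ s 2 := by
        rcases qs with ((h | h) | h) | h
        · exact (key c₂ hy ((h.mul_right _).mul_right _)).elim
        · exact (key c₂ hy ((h.mul_left _).mul_right _)).elim
        · exact h
        · exact (key c₂ hy (h.mul_left _)).elim
      rcases q₁ with (h | h) | h
      · exact key c₂ hy ((h.mul_right _).mul_right _)
      · exact key c₂ hy ((h.mul_left _).mul_right _)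
      · exact key c₁ h ((h2.mul_left _).mul_right _)
    · have h3 : l ∣ s 3 := by
        rcases qs with ((h | h) | h) | h
        · exact (key c₃ hy ((h.mul_right _).mul_right _)).elim
        · exact (key c₃ hy ((h.mul_left _).mul_right _)).elim
        · exact (key c₃ hy (h.mul_left _)).elim
        · exact h
      rcases q₁ with (h | h) | h
      · exact key c₃ hy ((h.mul_right _).mul_right _)
      · exact key c₃ hy ((h.mul_left _).mul_right _)
      · exact key c₁ h (h3.mul_left _)
  · intro i
    fin_cases i
    · exact abs_le_of_sq_eq_mul (by dsimp [torsorMap]; ring) n₁ h₁ h₂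
    · exact (abs_of_nonneg n₁).trans_le h₁
    · exact abs_le_of_sq_eq_mul (by dsimp [torsorMap]; ring) n₁ h₁ hs
    · exact (abs_of_nonneg n₂).trans_le h₂
    · exact abs_le_of_sq_eq_mul (by dsimp [torsorMap]; ring) n₂ h₂ hs
    · exact (abs_of_pos ns).trans_le hs
    · exact (abs_neg _).trans_le hy
  · dsimp [torsorMap]; ring
  · dsimp [torsorMap]; ring
  · dsimp [torsorMap]; ring
  · dsimp [torsorMap]; ring
  · dsimp [torsorMap]; ring
  · dsimp [torsorMap]; ring
  · dsimp [torsorMap]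
    linear_combination s 0 ^ 2 * s 1 * s 2 ^ 2 * y 0 * y 1 ^ 2 * ht
  · dsimp [torsorMap]
    linear_combination -s 0 ^ 2 * s 1 ^ 2 * s 2 * y 0 ^ 2 * y 1 * ht
  · dsimp [torsorMap]
    linear_combination -s 0 ^ 3 * s 1 ^ 2 * s 2 ^ 2 * s 3 * y 0 * y 1 * ht
  · exact fun h => ns.ne' h.2.2.2.2
  · exact fun h => ns.ne' h.2.2.2.2
  · exact fun h => ns.ne' h.2.2.1

theorem IsSurfacePoint.exists_torsorPoint {N : ℤ} {x : Fin 7 → ℤ} (h : IsSurfacePoint N x)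
    (hpos : 0 < x 5) : ∃ p, IsTorsorPoint_s18 N p ∧ torsorMap p = x := by
  obtain ⟨hprim, hht, -, -, -, e₄, e₅, e₆, -, -, e₉, -⟩ := h
  obtain ⟨u, a, b, c, hu, hc, hbez, h0, h1, h2, h3, h4, h5⟩ :=
    exists_veronese_parametrization (x₁ := x 0) hpos (by linarith) (sub_eq_zero.1 e₅)
      (sub_eq_zero.1 e₆)
  have hw : c * x 6 = -(u * a * b * (a + b)) := by
    rw [h0, h2, h4, h5] at e₉
    exact mul_left_cancel₀ (mul_pos hu hc).ne' (by linear_combination e₉)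
  have huw : IsCoprime u (x 6) := by
    refine isCoprime_of_prime_dvd (fun h => hu.ne' h.1) fun l hl hlu hl6 => ?_
    refine (primitive_iff_forall_prime x).1 hprim l hl fun i => ?_
    fin_cases i
    · exact h0 ▸ (hlu.mul_right _).mul_right _
    · exact h1 ▸ hlu.mul_right _
    · exact h2 ▸ (hlu.mul_right _).mul_right _
    · exact h3 ▸ hlu.mul_right _
    · exact h4 ▸ (hlu.mul_right _).mul_right _
    · exact h5 ▸ hlu.mul_right _
    · exact hl6
  obtain ⟨s₁, s₂, s₃, y₁, y₂, y₃, p₁, p₂, p₃, rfl, rfl, rfl, h6, ht, c₁, c₂, c₃, c₁₂, c₁₃, c₂₃⟩ :=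
    exists_torsor_coordinates_s18 hu hc hbez hw huw
  have hmap : torsorMap (![u, s₁, s₂, s₃], ![y₁, y₂, y₃]) = x := by
    ext i
    fin_cases i
    · dsimp [torsorMap]; rw [h0]; ring
    · dsimp [torsorMap]; rw [h1]; ring
    · dsimp [torsorMap]; rw [h2]; ring
    · dsimp [torsorMap]; rw [h3]; ring
    · dsimp [torsorMap]; rw [h4]; ring
    · dsimp [torsorMap]; rw [h5]; ring
    · dsimp [torsorMap]; rw [h6]
  refine ⟨(![u, s₁, s₂, s₃], ![y₁, y₂, y₃]), ⟨?_, ?_, ?_, ?_, ht, hu, p₁, p₂, p₃, c₁, c₂, c₃, c₁₂,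
    c₁₃, c₂₃⟩, hmap⟩
  · exact (le_abs_self _).trans ((congrArg abs (congrFun hmap 5)).trans_le (hht 5))
  · exact ((abs_neg _).symm.trans (congrArg abs (congrFun hmap 6))).trans_le (hht 6)
  · exact (le_abs_self _).trans ((congrArg abs (congrFun hmap 1)).trans_le (hht 1))
  · exact (le_abs_self _).trans ((congrArg abs (congrFun hmap 3)).trans_le (hht 3))

theorem eq_of_mul_eq_mul_of_isCoprime {s y t s' y' t' : ℤ} (hs : 0 < s) (hs' : 0 < s')
    (h : IsCoprime y t) (h' : IsCoprime y' t') (hsy : s * y = s' * y') (hst : s * t = s' * t') :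
    s = s' := by
  obtain ⟨m, n, h⟩ := h
  obtain ⟨m', n', h'⟩ := h'
  refine Int.dvd_antisymm hs.le hs'.le ⟨m' * y + n' * t, ?_⟩ ⟨m * y' + n * t', ?_⟩
  · linear_combination -s' * h' - m' * hsy - n' * hst
  · linear_combination -s * h + m * hsy + n * hst

theorem IsTorsorPoint_s18.exists_bezout {N : ℤ} {p : (Fin 4 → ℤ) × (Fin 3 → ℤ)}
    (h : IsTorsorPoint_s18 N p) : ∃ m n r, m * (p.1 1 * p.2 0) + n * (-(p.1 2 * p.2 1)) +
      r * (p.1 0 * p.1 1 * p.1 2 * p.1 3) = 1 := by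
  have c₁ := h.coprime_y_one
  have c₂ := h.coprime_y_two
  rw [IsCoprime.mul_right_iff, IsCoprime.mul_right_iff] at c₁ c₂
  obtain ⟨⟨c₁₀, c₁₂⟩, c₁₃⟩ := c₁
  obtain ⟨⟨c₂₀, c₂₁⟩, c₂₃⟩ := c₂
  obtain ⟨g, hg⟩ : ∃ g : ℤ, g = Int.gcd (p.1 1 * p.2 0) (-(p.1 2 * p.2 1)) := ⟨_, rfl⟩
  have ga : g ∣ p.1 1 * p.2 0 := hg ▸ Int.gcd_dvd_left ..
  have gb : g ∣ p.1 2 * p.2 1 := dvd_neg.1 (hg ▸ Int.gcd_dvd_right ..)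
  have g₀ : IsCoprime g (p.1 0) := by
    refine isCoprime_of_prime_dvd (fun h0 => h.pos_zero.ne' h0.2) fun l hl hlg hl0 => ?_
    exact hl.not_isUnit (h.coprime_one_two.isUnit_of_dvd'
      ((c₁₀.symm.of_isCoprime_of_dvd_left hl0).dvd_of_dvd_mul_right (hlg.trans ga))
      ((c₂₀.symm.of_isCoprime_of_dvd_left hl0).dvd_of_dvd_mul_right (hlg.trans gb)))
  have g₁ : IsCoprime g (p.1 1) :=
    (h.coprime_one_two.symm.mul_left c₂₁).of_isCoprime_of_dvd_left gb
  have g₂ : IsCoprime g (p.1 2) := (h.coprime_one_two.mul_left c₁₂).of_isCoprime_of_dvd_left ga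
  have g₃ : IsCoprime g (p.1 3) := (h.coprime_one_three.mul_left c₁₃).of_isCoprime_of_dvd_left ga
  obtain ⟨m, n, hmn⟩ := ((g₀.mul_right g₁).mul_right g₂).mul_right g₃
  rw [hg, Int.gcd_eq_gcd_ab] at hmn
  exact ⟨m * Int.gcdA (p.1 1 * p.2 0) (-(p.1 2 * p.2 1)),
    m * Int.gcdB (p.1 1 * p.2 0) (-(p.1 2 * p.2 1)), n, by linear_combination hmn⟩

theorem injOn_torsorMap (N : ℤ) : Set.InjOn torsorMap {p | IsTorsorPoint_s18 N p} := by
  rintro ⟨s, y⟩ h ⟨s', y'⟩ h' heq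
  have hbez := h.exists_bezout
  have hbez' := h'.exists_bezout
  obtain ⟨-, -, -, -, ht, p₀, p₁, p₂, p₃, c₁, c₂, c₃, -⟩ := h
  obtain ⟨-, -, -, -, ht', p₀', p₁', p₂', p₃', c₁', c₂', c₃', -⟩ := h'
  dsimp only at *
  have q2 : s 0 ^ 2 * s 1 ^ 2 * s 2 * s 3 * y 0 = s' 0 ^ 2 * s' 1 ^ 2 * s' 2 * s' 3 * y' 0 :=
    congrFun heq 2
  have q4 : -(s 0 ^ 2 * s 1 * s 2 ^ 2 * s 3 * y 1) = -(s' 0 ^ 2 * s' 1 * s' 2 ^ 2 * s' 3 * y' 1) :=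
    congrFun heq 4
  have q5 : s 0 ^ 3 * s 1 ^ 2 * s 2 ^ 2 * s 3 ^ 2 = s' 0 ^ 3 * s' 1 ^ 2 * s' 2 ^ 2 * s' 3 ^ 2 :=
    congrFun heq 5
  have hc : 0 < s 0 * s 1 * s 2 * s 3 := by positivity
  have hc' : 0 < s' 0 * s' 1 * s' 2 * s' 3 := by positivity
  obtain ⟨ha, hb, hcc⟩ := eq_of_primitive_of_proportional hc hc' hbez hbez'
    (mul_left_cancel₀ (show s 0 * s' 0 * (s 0 * s 1 * s 2 * s 3) * (s' 0 * s' 1 * s' 2 * s' 3) ≠ 0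
      by positivity) (by
        linear_combination s' 0 ^ 3 * s' 1 ^ 2 * s' 2 ^ 2 * s' 3 ^ 2 * q2 -
          s' 0 ^ 2 * s' 1 ^ 2 * s' 2 * s' 3 * y' 0 * q5))
    (mul_left_cancel₀ (show s 0 * s' 0 * (s 0 * s 1 * s 2 * s 3) * (s' 0 * s' 1 * s' 2 * s' 3) ≠ 0
      by positivity) (by
        linear_combination s' 0 ^ 3 * s' 1 ^ 2 * s' 2 ^ 2 * s' 3 ^ 2 * q4 +
          s' 0 ^ 2 * s' 1 * s' 2 ^ 2 * s' 3 * y' 1 * q5))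
  have e0 : s 0 = s' 0 := mul_right_cancel₀ (pow_pos hc 2).ne' (by
    nth_rewrite 2 [hcc]
    linear_combination q5)
  have hd : s 1 * s 2 * s 3 = s' 1 * s' 2 * s' 3 := mul_left_cancel₀ p₀.ne' (by
    rw [← e0] at hcc
    linear_combination hcc)
  rw [neg_inj] at hb
  have e1 : s 1 = s' 1 := eq_of_mul_eq_mul_of_isCoprime p₁ p₁'
    (c₁.of_isCoprime_of_dvd_right (Dvd.intro_left (s 0) (by ring) : s 2 * s 3 ∣ _))
    (c₁'.of_isCoprime_of_dvd_right (Dvd.intro_left (s' 0) (by ring) : s' 2 * s' 3 ∣ _))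
    ha (by linear_combination hd)
  have e2 : s 2 = s' 2 := eq_of_mul_eq_mul_of_isCoprime p₂ p₂'
    (c₂.of_isCoprime_of_dvd_right (Dvd.intro_left (s 0) (by ring) : s 1 * s 3 ∣ _))
    (c₂'.of_isCoprime_of_dvd_right (Dvd.intro_left (s' 0) (by ring) : s' 1 * s' 3 ∣ _))
    hb (by linear_combination hd)
  have e3 : s 3 = s' 3 := mul_left_cancel₀ (mul_pos p₁ p₂).ne' (by rw [hd, e1, e2])
  have f0 : y 0 = y' 0 := mul_left_cancel₀ p₁.ne' (by rw [ha, e1])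
  have f1 : y 1 = y' 1 := mul_left_cancel₀ p₂.ne' (by rw [hb, e2])
  have f2 : y 2 = y' 2 := mul_left_cancel₀ p₃.ne' (by
    rw [← e1, ← e2, ← e3, ← f0, ← f1] at ht'
    linear_combination ht - ht')
  refine Prod.ext (funext fun i => ?_) (funext fun i => ?_)
  · fin_cases i <;> assumption
  · fin_cases i <;> assumption

theorem finite_setOf_isSurfacePoint (N : ℤ) : {x | IsSurfacePoint N x}.Finite :=
  (Set.finite_Icc (fun _ => -N) (fun _ => N)).subset fun _ hx =>
    ⟨fun i => (abs_le.1 (hx.2.1 i)).1, fun i => (abs_le.1 (hx.2.1 i)).2⟩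

theorem finite_setOf_isTorsorPoint (N : ℤ) : {p | IsTorsorPoint_s18 N p}.Finite :=
  Set.Finite.of_finite_image ((finite_setOf_isSurfacePoint N).subset (by
    rintro _ ⟨p, hp, rfl⟩
    exact hp.isSurfacePoint)) (injOn_torsorMap N)

theorem ncard_isSurfacePoint (N : ℤ) :
    {x | IsSurfacePoint N x}.ncard = 2 * {p | IsTorsorPoint_s18 N p}.ncard := by
  rw [ncard_eq_two_mul_add_of_involutive (finite_setOf_isSurfacePoint N) neg_involutive
    (fun x hx => IsSurfacePoint.neg hx) (fun x => x 5) fun x => rfl]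
  have hzero : {x ∈ {x | IsSurfacePoint N x} | x 5 = 0} = ∅ :=
    Set.eq_empty_of_forall_notMem fun x hx => hx.1.apply_five_ne_zero hx.2
  have himage : {x ∈ {x | IsSurfacePoint N x} | 0 < x 5} = torsorMap '' {p | IsTorsorPoint_s18 N p} := by
    ext x
    constructor
    · rintro ⟨hx, hpos⟩
      exact hx.exists_torsorPoint hpos
    · rintro ⟨p, hp, rfl⟩
      have := hp.pos_zero
      have := hp.pos_one
      have := hp.pos_two
      have := hp.pos_three
      refine ⟨hp.isSurfacePoint, ?_⟩
      change 0 < p.1 0 ^ 3 * p.1 1 ^ 2 * p.1 2 ^ 2 * p.1 3 ^ 2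
      positivity
  rw [hzero, himage, (injOn_torsorMap N).ncard_image, Set.ncard_empty, add_zero]

theorem IsTorsorPoint_s18.neg_right {N : ℤ} {p : (Fin 4 → ℤ) × (Fin 3 → ℤ)}
    (h : IsTorsorPoint_s18 N p) : IsTorsorPoint_s18 N (p.1, -p.2) where
  height_s := h.height_s
  height_y := by
    rw [← abs_neg]
    convert h.height_y using 2
    simp only [Pi.neg_apply]
    ring
  height_one := by simpa using h.height_one
  height_two := by simpa using h.height_two
  torsor := by
    simp only [Pi.neg_apply]
    linear_combination -h.torsor
  pos_zero := h.pos_zero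
  pos_one := h.pos_one
  pos_two := h.pos_two
  pos_three := h.pos_three
  coprime_y_one := h.coprime_y_one.neg_left
  coprime_y_two := h.coprime_y_two.neg_left
  coprime_y_three := h.coprime_y_three.neg_left
  coprime_one_two := h.coprime_one_two
  coprime_one_three := h.coprime_one_three
  coprime_two_three := h.coprime_two_three

theorem ncard_isTorsorPoint_zero_le {N : ℤ} (hN : 0 ≤ N) :
    ({p ∈ {p | IsTorsorPoint_s18 N p} | p.2 0 = 0}.ncard : ℤ) ≤ 3 * N := by
  lift N to ℕ using hN
  let g : ℤ × ℤ → (Fin 4 → ℤ) × (Fin 3 → ℤ) := fun q => (![1, q.1, 1, 1], ![0, q.2, q.2])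
  let box : Finset (ℤ × ℤ) :=
    Finset.Icc 1 (Nat.sqrt N : ℤ) ×ˢ Finset.Icc (-(Nat.sqrt N : ℤ)) (Nat.sqrt N)
  have hsub : {p ∈ {p | IsTorsorPoint_s18 N p} | p.2 0 = 0} ⊆ g '' (box : Set (ℤ × ℤ)) := by
    rintro ⟨s, y⟩ ⟨⟨hs, -, -, h₂, ht, p₀, p₁, p₂, p₃, c₁, -⟩, h0⟩
    dsimp only at *
    rw [h0, isCoprime_zero_left, IsUnit.mul_iff, IsUnit.mul_iff] at c₁
    have one_of_isUnit {e : ℤ} (he : IsUnit e) (hpos : 0 < e) : e = 1 := by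
      rcases Int.isUnit_iff.1 he with h | h <;> omega
    have e0 := one_of_isUnit c₁.1.1 p₀
    have e2 := one_of_isUnit c₁.1.2 p₂
    have e3 := one_of_isUnit c₁.2 p₃
    rw [e0, e2, e3] at hs
    rw [e0, e2] at h₂
    rw [h0, e2, e3] at ht
    have sqrt_bound {e : ℤ} (he : e ^ 2 ≤ N) : |e| ≤ Nat.sqrt N := by
      rw [Int.abs_eq_natAbs]
      refine Int.ofNat_le.2 (Nat.le_sqrt'.2 ?_)
      zify
      simpa using he
    have b₁ := sqrt_bound (e := s 1) (by linarith)
    have b₂ := sqrt_bound (e := y 1) (by linarith)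
    refine ⟨(s 1, y 1), ?_, Prod.ext (funext fun i => ?_) (funext fun i => ?_)⟩
    · simp only [box, Finset.coe_product, Finset.coe_Icc, Set.mem_prod, Set.mem_Icc]
      exact ⟨⟨p₁, (abs_le.1 b₁).2⟩, abs_le.1 b₂⟩
    · fin_cases i
      exacts [e0.symm, rfl, e2.symm, e3.symm]
    · fin_cases i
      exacts [h0.symm, rfl, by change y 1 = y 2; linarith]
  have hcard := (Set.ncard_le_ncard hsub (box.finite_toSet.image g)).trans
    (Set.ncard_image_le box.finite_toSet)
  rw [Set.ncard_coe_finset] at hcard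
  have hbox : box.card = Nat.sqrt N * (2 * Nat.sqrt N + 1) := by
    rw [Finset.card_product, Int.card_Icc, Int.card_Icc]
    congr 1 <;> omega
  have hsq := Nat.sqrt_le N
  rw [hbox] at hcard
  have hself : Nat.sqrt N ≤ Nat.sqrt N * Nat.sqrt N := Nat.le_mul_self _
  exact_mod_cast (show _ ≤ 3 * N by nlinarith)

theorem abs_cast_le_iff_floor {n : ℤ} {B : ℝ} : |(n : ℝ)| ≤ B ↔ |n| ≤ ⌊B⌋ := by
  rw [Int.le_floor, Int.cast_abs]

theorem stmt_18 :
    ∃ C : ℝ, ∀ B : ℝ, 1 ≤ B →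
      |(1 / 2 : ℝ) * (Nat.card {x : Fin 7 → ℤ //
            Finset.gcd Finset.univ (fun i => (x i).natAbs) = 1 ∧
            (∀ i, |(x i : ℝ)| ≤ B) ∧
            x 0 ^ 2 - x 1 * x 3 = 0 ∧
            x 0 * x 4 - x 2 * x 3 = 0 ∧
            x 0 * x 2 - x 1 * x 4 = 0 ∧
            x 0 * x 5 - x 2 * x 4 = 0 ∧
            x 1 * x 5 - x 2 ^ 2 = 0 ∧
            x 3 * x 5 - x 4 ^ 2 = 0 ∧
            x 0 ^ 2 + x 0 * x 3 + x 4 * x 6 = 0 ∧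
            x 0 * x 1 + x 0 ^ 2 + x 2 * x 6 = 0 ∧
            x 0 * x 2 + x 0 * x 4 + x 5 * x 6 = 0 ∧
            ¬ (x 0 = 0 ∧ x 1 = 0 ∧ x 2 = 0 ∧ x 4 = 0 ∧ x 5 = 0) ∧
            ¬ (x 0 = 0 ∧ x 2 = 0 ∧ x 3 = 0 ∧ x 4 = 0 ∧ x 5 = 0) ∧
            ¬ (x 2 = 0 ∧ x 4 = 0 ∧ x 5 = 0 ∧ x 0 + x 3 = 0 ∧ x 0 + x 1 = 0)} : ℝ)
          - 2 * (Nat.card {sy : (Fin 4 → ℤ) × (Fin 3 → ℤ) //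
            max (max |((sy.1 0 ^ 3 * sy.1 1 ^ 2 * sy.1 2 ^ 2 * sy.1 3 ^ 2 : ℤ) : ℝ)|
                     |((sy.2 0 * sy.2 1 * sy.2 2 : ℤ) : ℝ)|)
                (max |((sy.1 0 * sy.1 1 ^ 2 * sy.2 0 ^ 2 : ℤ) : ℝ)|
                     |((sy.1 0 * sy.1 2 ^ 2 * sy.2 1 ^ 2 : ℤ) : ℝ)|) ≤ B ∧
            sy.1 1 * sy.2 0 - sy.1 2 * sy.2 1 + sy.1 3 * sy.2 2 = 0 ∧
            0 < sy.1 0 ∧ 0 < sy.1 1 ∧ 0 < sy.1 2 ∧ 0 < sy.1 3 ∧ 0 < sy.2 0 ∧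
            Int.gcd (sy.2 0) (sy.1 0 * sy.1 2 * sy.1 3) = 1 ∧
            Int.gcd (sy.2 1) (sy.1 0 * sy.1 1 * sy.1 3) = 1 ∧
            Int.gcd (sy.2 2) (sy.1 0 * sy.1 1 * sy.1 2) = 1 ∧
            Int.gcd (sy.1 1) (sy.1 2) = 1 ∧
            Int.gcd (sy.1 1) (sy.1 3) = 1 ∧
            Int.gcd (sy.1 2) (sy.1 3) = 1} : ℝ)|
        ≤ C * B := by
  refine ⟨3, fun B hB => ?_⟩
  have hN : 0 ≤ ⌊B⌋ := Int.floor_nonneg.2 (by linarith)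
  have hzero := ncard_isTorsorPoint_zero_le hN
  have htorsor := ncard_eq_two_mul_add_of_involutive (finite_setOf_isTorsorPoint ⌊B⌋)
    (ι := fun p => (p.1, -p.2)) (fun p => by simp) (fun p hp => IsTorsorPoint_s18.neg_right hp)
    (fun p => p.2 0) fun p => rfl
  have hsurface := ncard_isSurfacePoint ⌊B⌋
  simp only [abs_cast_le_iff_floor]
  change |(1 / 2 : ℝ) * ({x | IsSurfacePoint ⌊B⌋ x}.ncard : ℝ) - 2 * _| ≤ _
  rw [show Nat.card _ = {p ∈ {p | IsTorsorPoint_s18 ⌊B⌋ p} | 0 < p.2 0}.ncard from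
    Nat.card_congr (Equiv.subtypeEquivRight fun p => ?_)]
  · have hfloor := Int.floor_le B
    have hzero' : ({p ∈ {p | IsTorsorPoint_s18 ⌊B⌋ p} | p.2 0 = 0}.ncard : ℝ) ≤ 3 * ⌊B⌋ := by
      exact_mod_cast hzero
    rw [hsurface, htorsor]
    push_cast
    rw [abs_of_nonneg (by ring_nf; positivity)]
    linarith
  · simp only [max_le_iff, abs_cast_le_iff_floor, ← Int.isCoprime_iff_gcd_eq_one]
    constructor
    · rintro ⟨⟨⟨hs, hy⟩, h₁, h₂⟩, ht, p₀, p₁, p₂, p₃, hpos, c₁, c₂, c₃, c₁₂, c₁₃, c₂₃⟩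
      exact ⟨⟨(le_abs_self _).trans hs, hy, (le_abs_self _).trans h₁, (le_abs_self _).trans h₂, ht,
        p₀, p₁, p₂, p₃, c₁, c₂, c₃, c₁₂, c₁₃, c₂₃⟩, hpos⟩
    · rintro ⟨⟨hs, hy, h₁, h₂, ht, p₀, p₁, p₂, p₃, c₁, c₂, c₃, c₁₂, c₁₃, c₂₃⟩, hpos⟩
      refine ⟨⟨⟨?_, hy⟩, ?_, ?_⟩, ht, p₀, p₁, p₂, p₃, hpos, c₁, c₂, c₃, c₁₂, c₁₃, c₂₃⟩
      · rwa [abs_of_nonneg (by positivity)]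
      · rwa [abs_of_nonneg (by positivity)]
      · rwa [abs_of_nonneg (by positivity)]
end
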